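/- arXiv:2106.10128 — 2 statements merged into one kernel-verified Lean document; each statement's English description precedes it below -/
import Mathlib

section
/- (Theorem 6) Let X be the Lie–Bäcklund field on J^∞(ℝ,ℝ²) determined by admissible principal components ξ, η^0_1, η^0_2 that depend only on the coordinates (x, y^0_1, y^0_2, y^1_1, y^1_2). If X is exponentiable to a flow Φ_t = (Ξ_t, H^α_{L,t}) such that Ξ_t and H^0_{L,t} (L = 1,2) do not depend on any coordinate y^γ_M with γ ≥ 2, then identically on the domain: (i) Σ_{M=1}^{2} M^R_M ∂ξ/∂y^1_M = 0 and Σ_{M=1}^{2} M^R_M ∂η^0_L/∂y^1_M = 0 for all L, R ∈ {1,2}; and (ii) Σ_{M=1}^{2} Q^R_M ∂ξ/∂y^1_M = 0 and Σ_{M=1}^{2} Q^R_M ∂η^0_L/∂y^1_M = 0 for all L, R ∈ {1,2}. -/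
open scoped BigOperators

/-- The infinite jet space `J^∞(ℝ, ℝ²)`: coordinates `x` and `y^k_L`
(`L ∈ Fin 2`, `k ∈ ℕ`). -/
abbrev JetB := ℝ × (Fin 2 × ℕ → ℝ)

/-- Partial derivative with respect to the coordinate `x`. -/
noncomputable def pdX (F : JetB → ℝ) : JetB → ℝ :=
  fun p => deriv (fun t => F (t, p.2)) p.1

/-- Partial derivative with respect to the coordinate `y^k_L`, `q = (L, k)`. -/
noncomputable def pdY (q : Fin 2 × ℕ) (F : JetB → ℝ) : JetB → ℝ :=
  fun p => deriv (fun t => F (p.1, Function.update p.2 q t)) (p.2 q)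

/-- A function on `J^∞(ℝ,ℝ²)` is admissible if it is a `C^∞` function of finitely
many of the coordinates. -/
def Admissible (F : JetB → ℝ) : Prop :=
  ∃ (S : Finset (Fin 2 × ℕ)) (g : ℝ × (↥S → ℝ) → ℝ),
    ContDiff ℝ (⊤ : ℕ∞) g ∧ ∀ p : JetB, F p = g (p.1, fun a => p.2 a.1)

/-- The total derivative `D = ∂/∂x + Σ_{L,k} y^{k+1}_L ∂/∂y^k_L`. -/
noncomputable def totD (F : JetB → ℝ) : JetB → ℝ :=
  fun p => pdX F p + ∑ᶠ q : Fin 2 × ℕ, p.2 (q.1, q.2 + 1) * pdY q F p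

/-- The components `η^k_L` of the Lie–Bäcklund field with principal components
`ξ, η^0_1, η^0_2`, determined by the recursion `η^{k+1}_L = D η^k_L − y^{k+1}_L D ξ`. -/
noncomputable def etaLB (ξ : JetB → ℝ) (η0 : Fin 2 → JetB → ℝ) (L : Fin 2) :
    ℕ → JetB → ℝ
  | 0 => η0 L
  | (k + 1) => fun p => totD (etaLB ξ η0 L k) p - p.2 (L, k + 1) * totD ξ p

/-- `F` depends only on the coordinates `(x, y^0_1, y^0_2, y^1_1, y^1_2)`. -/
def LowOrder (F : JetB → ℝ) : Prop :=
  ∀ p q : JetB, p.1 = q.1 →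
    (∀ (L : Fin 2) (k : ℕ), k ≤ 1 → p.2 (L, k) = q.2 (L, k)) → F p = F q

/-- `O_L = ∂η^0_L/∂x − y^1_L ∂ξ/∂x`. -/
noncomputable def Ocomp (ξ : JetB → ℝ) (η0 : Fin 2 → JetB → ℝ) (L : Fin 2) :
    JetB → ℝ :=
  fun p => pdX (η0 L) p - p.2 (L, 1) * pdX ξ p

/-- `N^Q_L = ∂η^0_L/∂y^0_Q − y^1_L ∂ξ/∂y^0_Q`. -/
noncomputable def Ncomp (ξ : JetB → ℝ) (η0 : Fin 2 → JetB → ℝ) (Q L : Fin 2) :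
    JetB → ℝ :=
  fun p => pdY (Q, 0) (η0 L) p - p.2 (L, 1) * pdY (Q, 0) ξ p

/-- `M^Q_L = ∂η^0_L/∂y^1_Q − y^1_L ∂ξ/∂y^1_Q`. -/
noncomputable def Mcomp (ξ : JetB → ℝ) (η0 : Fin 2 → JetB → ℝ) (Q L : Fin 2) :
    JetB → ℝ :=
  fun p => pdY (Q, 1) (η0 L) p - p.2 (L, 1) * pdY (Q, 1) ξ p

/-- `Q^R_M = ξ ∂M^R_M/∂x + Σ_K η^0_K ∂M^R_M/∂y^0_K
+ Σ_K (O_K + Σ_Q y^1_Q N^Q_K) ∂M^R_M/∂y^1_K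
− (Σ_N M^R_N ∂O_M/∂y^1_N + Σ_Q M^R_Q N^Q_M + Σ_{N,Q} M^R_N y^1_Q ∂N^Q_M/∂y^1_N)`. -/
noncomputable def Qcomp (ξ : JetB → ℝ) (η0 : Fin 2 → JetB → ℝ) (R M : Fin 2) :
    JetB → ℝ :=
  fun p =>
    ξ p * pdX (Mcomp ξ η0 R M) p
      + (∑ K, η0 K p * pdY (K, 0) (Mcomp ξ η0 R M) p)
      + (∑ K, (Ocomp ξ η0 K p + ∑ Q, p.2 (Q, 1) * Ncomp ξ η0 Q K p) *
          pdY (K, 1) (Mcomp ξ η0 R M) p)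
      - ((∑ N, Mcomp ξ η0 R N p * pdY (N, 1) (Ocomp ξ η0 M) p)
          + (∑ Q, Mcomp ξ η0 R Q p * Ncomp ξ η0 Q M p)
          + (∑ N, ∑ Q, Mcomp ξ η0 R N p * p.2 (Q, 1) * pdY (N, 1) (Ncomp ξ η0 Q M) p))

/-- A family `F t` of functions, each an admissible function of the coordinates, with
the finite set of relevant coordinates independent of `t` and `C^∞` joint dependence. -/
def AdmissibleT (F : ℝ → JetB → ℝ) : Prop :=
  ∃ (S : Finset (Fin 2 × ℕ)) (g : ℝ × ℝ × (↥S → ℝ) → ℝ),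
    ContDiff ℝ (⊤ : ℕ∞) g ∧ ∀ (t : ℝ) (p : JetB), F t p = g (t, p.1, fun a => p.2 a.1)

/-- `Φ` is a flow exponentiating the Lie–Bäcklund field with principal components
`ξ, η0` on `J^∞(ℝ,ℝ²)`. -/
def IsFlowOf (ξ : JetB → ℝ) (η0 : Fin 2 → JetB → ℝ) (Φ : ℝ → JetB → JetB) : Prop :=
  AdmissibleT (fun t p => (Φ t p).1) ∧
  (∀ q : Fin 2 × ℕ, AdmissibleT fun t p => (Φ t p).2 q) ∧
  Φ 0 = id ∧ (∀ s t : ℝ, Φ t ∘ Φ s = Φ (t + s)) ∧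
  (∀ p, deriv (fun t => (Φ t p).1) 0 = ξ p) ∧
  (∀ (L : Fin 2) (k : ℕ) (p : JetB),
    deriv (fun t => (Φ t p).2 (L, k)) 0 = etaLB ξ η0 L k p)

/-- The coordinates `(x, (y^0_1, y^0_2), (y^1_1, y^1_2))` of the first-order jet space. -/
abbrev JetOne := ℝ × (Fin 2 → ℝ) × (Fin 2 → ℝ)

namespace JetOne

/-- Truncation of an infinite jet to first order. -/
def trunc (p : JetB) : JetOne := (p.1, fun L => p.2 (L, 0), fun L => p.2 (L, 1))

/-- Extension of a first-order jet by zero. -/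
def extend (z : JetOne) : JetB :=
  (z.1, fun q => if q.2 = 0 then z.2.1 q.1 else if q.2 = 1 then z.2.2 q.1 else 0)

/-- The coordinate direction of `x`. -/
def dirX : JetOne := (1, 0, 0)

/-- The coordinate direction of `y^0_L`. -/
def dirY (L : Fin 2) : JetOne := (0, Pi.single L 1, 0)

/-- The coordinate direction of `y^1_L`. -/
def dirY' (L : Fin 2) : JetOne := (0, 0, Pi.single L 1)

lemma map_eq_sum (A : JetOne →L[ℝ] ℝ) (a : ℝ) (b c : Fin 2 → ℝ) :
    A (a, b, c) = a * A dirX + (∑ K, b K * A (dirY K)) + ∑ K, c K * A (dirY' K) := by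
  have h : ((a, b, c) : JetOne) =
      a • dirX + (∑ K, b K • dirY K) + ∑ K, c K • dirY' K := by
    refine Prod.ext ?_ (Prod.ext ?_ ?_)
    · simp [dirX, dirY, dirY']
    · ext i; fin_cases i <;> simp [dirX, dirY, dirY']
    · ext i; fin_cases i <;> simp [dirX, dirY, dirY']
  rw [h]
  simp only [map_add, map_sum, map_smul, smul_eq_mul]

lemma exists_eq_comp_trunc {f : JetB → ℝ} (hf : Admissible f) (hlow : LowOrder f) :
    ∃ F : JetOne → ℝ, ContDiff ℝ (⊤ : ℕ∞) F ∧ f = fun p => F (trunc p) := by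
  obtain ⟨S, g, hg, hfg⟩ := hf
  refine ⟨fun z => f (extend z), ?_, ?_⟩
  · have h : (fun z => f (extend z)) =
        fun z : JetOne => g (z.1, fun a : S => (extend z).2 a.1) := by
      ext z; rw [hfg]; rfl
    rw [h]
    refine hg.comp (contDiff_fst.prodMk (contDiff_pi.2 fun a => ?_))
    unfold extend
    dsimp only
    split_ifs <;> fun_prop
  · ext p
    apply hlow
    · rfl
    · intro L k hk
      interval_cases k <;> simp [extend, trunc]

lemma lowOrder_comp_trunc (F : JetOne → ℝ) : LowOrder fun p => F (trunc p) := by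
  intro p q h1 h2
  have : trunc p = trunc q := by
    simp only [trunc, h1, h2 _ 0 zero_le_one, h2 _ 1 le_rfl]
  simp only [this]

lemma pdX_comp_trunc {F : JetOne → ℝ} (hF : Differentiable ℝ F) :
    pdX (fun p => F (trunc p)) = fun p => fderiv ℝ F (trunc p) dirX := by
  ext p
  have h : HasDerivAt (fun t : ℝ => ((t, (trunc p).2) : JetOne)) dirX p.1 :=
    (hasDerivAt_id p.1).prodMk (hasDerivAt_const _ _)
  exact ((hF (trunc p)).hasFDerivAt.comp_hasDerivAt p.1 h).deriv

lemma pdY_zero_comp_trunc {F : JetOne → ℝ} (hF : Differentiable ℝ F) (L : Fin 2) :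
    pdY (L, 0) (fun p => F (trunc p)) = fun p => fderiv ℝ F (trunc p) (dirY L) := by
  ext p
  have h : HasDerivAt (fun t : ℝ => trunc (p.1, Function.update p.2 (L, 0) t))
      (dirY L) (p.2 (L, 0)) := by
    refine (hasDerivAt_const _ _).prodMk (HasDerivAt.prodMk ?_ ?_)
    · refine hasDerivAt_pi.2 fun K => ?_
      by_cases hK : K = L
      · subst hK; simpa using hasDerivAt_id' (p.2 (K, 0))
      · simpa [Function.update, hK] using hasDerivAt_const (p.2 (L, 0)) (p.2 (K, 0))
    · simpa [Function.update] using
        hasDerivAt_const (p.2 (L, 0)) (fun K => p.2 (K, 1))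
  have hp : trunc (p.1, Function.update p.2 (L, 0) (p.2 (L, 0))) = trunc p := by simp
  have hFp := (hF (trunc p)).hasFDerivAt
  rw [← hp] at hFp
  rw [← hp]
  exact (hFp.comp_hasDerivAt (p.2 (L, 0)) h).deriv

lemma pdY_one_comp_trunc {F : JetOne → ℝ} (hF : Differentiable ℝ F) (L : Fin 2) :
    pdY (L, 1) (fun p => F (trunc p)) = fun p => fderiv ℝ F (trunc p) (dirY' L) := by
  ext p
  have h : HasDerivAt (fun t : ℝ => trunc (p.1, Function.update p.2 (L, 1) t))
      (dirY' L) (p.2 (L, 1)) := by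
    refine (hasDerivAt_const _ _).prodMk (HasDerivAt.prodMk ?_ ?_)
    · simpa [Function.update] using
        hasDerivAt_const (p.2 (L, 1)) (fun K => p.2 (K, 0))
    · refine hasDerivAt_pi.2 fun K => ?_
      by_cases hK : K = L
      · subst hK; simpa using hasDerivAt_id' (p.2 (K, 1))
      · simpa [Function.update, hK] using hasDerivAt_const (p.2 (L, 1)) (p.2 (K, 1))
  have hp : trunc (p.1, Function.update p.2 (L, 1) (p.2 (L, 1))) = trunc p := by simp
  have hFp := (hF (trunc p)).hasFDerivAt
  rw [← hp] at hFp
  rw [← hp]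
  exact (hFp.comp_hasDerivAt (p.2 (L, 1)) h).deriv

lemma pdY_comp_trunc_of_two_le (F : JetOne → ℝ) (L : Fin 2) {k : ℕ} (hk : 2 ≤ k) (p : JetB) :
    pdY (L, k) (fun p => F (trunc p)) p = 0 := by
  have h : ∀ t, trunc (p.1, Function.update p.2 (L, k) t) = trunc p := by
    intro t
    have h0 : (0 : ℕ) ≠ k := by lia
    have h1 : (1 : ℕ) ≠ k := by lia
    simp [trunc, Function.update, h0, h1]
  simp [pdY, h]

lemma totD_comp_trunc {F : JetOne → ℝ} (hF : Differentiable ℝ F) (p : JetB) :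
    totD (fun p => F (trunc p)) p = fderiv ℝ F (trunc p) dirX
      + (∑ K, p.2 (K, 1) * fderiv ℝ F (trunc p) (dirY K))
      + ∑ K, p.2 (K, 2) * fderiv ℝ F (trunc p) (dirY' K) := by
  unfold totD
  rw [finsum_eq_sum_of_support_subset (s := Finset.univ ×ˢ Finset.range 2)]
  · rw [Finset.sum_product]
    simp only [Finset.sum_range_succ, Finset.sum_range_zero, pdX_comp_trunc hF,
      pdY_zero_comp_trunc hF, pdY_one_comp_trunc hF, Finset.sum_add_distrib, zero_add]
    ring
  · rintro ⟨L, k⟩ h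
    by_contra hk
    have hk2 : 2 ≤ k := by simpa [Nat.succ_le_iff] using hk
    exact h (by simp [pdY_comp_trunc_of_two_le F L hk2])

section Reduced

variable (ξ : JetOne → ℝ) (η : Fin 2 → JetOne → ℝ)

/-- `Ocomp` on first-order jets. -/
noncomputable def redO (L : Fin 2) (z : JetOne) : ℝ :=
  fderiv ℝ (η L) z dirX - z.2.2 L * fderiv ℝ ξ z dirX

/-- `Ncomp` on first-order jets. -/
noncomputable def redN (Q L : Fin 2) (z : JetOne) : ℝ :=
  fderiv ℝ (η L) z (dirY Q) - z.2.2 L * fderiv ℝ ξ z (dirY Q)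

/-- `Mcomp` on first-order jets. -/
noncomputable def redM (Q L : Fin 2) (z : JetOne) : ℝ :=
  fderiv ℝ (η L) z (dirY' Q) - z.2.2 L * fderiv ℝ ξ z (dirY' Q)

/-- The part of `η^1_L` that does not involve second-order coordinates. -/
noncomputable def redW (L : Fin 2) (z : JetOne) : ℝ :=
  redO ξ η L z + ∑ Q, z.2.2 Q * redN ξ η Q L z

/-- The part of the prolonged field that does not involve second-order coordinates. -/
noncomputable def horizField (z : JetOne) : JetOne :=
  (ξ z, fun L => η L z, fun L => redW ξ η L z)

/-- The coefficient of `y^2_R` in the prolonged field. -/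
noncomputable def vertField (R : Fin 2) (z : JetOne) : JetOne :=
  (0, 0, fun L => redM ξ η R L z)

variable {ξ η} (hξ : ContDiff ℝ (⊤ : ℕ∞) ξ) (hη : ∀ L, ContDiff ℝ (⊤ : ℕ∞) (η L))

lemma contDiff_fderiv_apply_const {F : JetOne → ℝ} (hF : ContDiff ℝ (⊤ : ℕ∞) F) (v : JetOne) :
    ContDiff ℝ (⊤ : ℕ∞) fun z => fderiv ℝ F z v :=
  (hF.fderiv_right (by simp)).clm_apply contDiff_const

include hξ hη

lemma contDiff_redO (L : Fin 2) : ContDiff ℝ (⊤ : ℕ∞) (redO ξ η L) := by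
  have h1 := contDiff_fderiv_apply_const hξ dirX
  have h2 := contDiff_fderiv_apply_const (hη L) dirX
  unfold redO
  fun_prop

lemma contDiff_redN (Q L : Fin 2) : ContDiff ℝ (⊤ : ℕ∞) (redN ξ η Q L) := by
  have h1 := contDiff_fderiv_apply_const hξ (dirY Q)
  have h2 := contDiff_fderiv_apply_const (hη L) (dirY Q)
  unfold redN
  fun_prop

lemma contDiff_redM (Q L : Fin 2) : ContDiff ℝ (⊤ : ℕ∞) (redM ξ η Q L) := by
  have h1 := contDiff_fderiv_apply_const hξ (dirY' Q)
  have h2 := contDiff_fderiv_apply_const (hη L) (dirY' Q)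
  unfold redM
  fun_prop

lemma contDiff_redW (L : Fin 2) : ContDiff ℝ (⊤ : ℕ∞) (redW ξ η L) := by
  have h1 := contDiff_redO hξ hη L
  have h2 := fun Q => contDiff_redN hξ hη Q L
  unfold redW
  fun_prop

lemma contDiff_horizField : ContDiff ℝ (⊤ : ℕ∞) (horizField ξ η) := by
  have h := contDiff_redW hξ hη
  unfold horizField
  fun_prop

lemma contDiff_vertField (R : Fin 2) : ContDiff ℝ (⊤ : ℕ∞) (vertField ξ η R) := by
  have h := contDiff_redM hξ hη R
  unfold vertField
  fun_prop

lemma Ocomp_comp_trunc (L : Fin 2) :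
    Ocomp (fun p => ξ (trunc p)) (fun L p => η L (trunc p)) L =
      fun p => redO ξ η L (trunc p) := by
  ext p
  simp only [Ocomp, pdX_comp_trunc (hξ.differentiable (by simp)),
    pdX_comp_trunc ((hη L).differentiable (by simp))]
  rfl

lemma Ncomp_comp_trunc (Q L : Fin 2) :
    Ncomp (fun p => ξ (trunc p)) (fun L p => η L (trunc p)) Q L =
      fun p => redN ξ η Q L (trunc p) := by
  ext p
  simp only [Ncomp, pdY_zero_comp_trunc (hξ.differentiable (by simp)),
    pdY_zero_comp_trunc ((hη L).differentiable (by simp))]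
  rfl

lemma Mcomp_comp_trunc (Q L : Fin 2) :
    Mcomp (fun p => ξ (trunc p)) (fun L p => η L (trunc p)) Q L =
      fun p => redM ξ η Q L (trunc p) := by
  ext p
  simp only [Mcomp, pdY_one_comp_trunc (hξ.differentiable (by simp)),
    pdY_one_comp_trunc ((hη L).differentiable (by simp))]
  rfl

lemma etaLB_one_comp_trunc (L : Fin 2) (p : JetB) :
    etaLB (fun p => ξ (trunc p)) (fun L p => η L (trunc p)) L 1 p =
      redW ξ η L (trunc p) + ∑ Q, p.2 (Q, 2) * redM ξ η Q L (trunc p) := by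
  simp only [etaLB, totD_comp_trunc (hξ.differentiable (by simp)),
    totD_comp_trunc ((hη L).differentiable (by simp)), redW, redO, redN, redM,
    Fin.sum_univ_two, zero_add]
  simp only [trunc]
  ring

lemma fderiv_redW_apply (M : Fin 2) (z v : JetOne) :
    fderiv ℝ (redW ξ η M) z v = fderiv ℝ (redO ξ η M) z v
      + ∑ Q, (v.2.2 Q * redN ξ η Q M z + z.2.2 Q * fderiv ℝ (redN ξ η Q M) z v) := by
  have hO := ((contDiff_redO hξ hη M).differentiable (by simp) z).hasFDerivAt
  have hN := fun Q => ((contDiff_redN hξ hη Q M).differentiable (by simp) z).hasFDerivAt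
  have hc := fun Q : Fin 2 => ((ContinuousLinearMap.proj (R := ℝ) (φ := fun _ : Fin 2 => ℝ) Q).comp
    ((ContinuousLinearMap.snd ℝ (Fin 2 → ℝ) (Fin 2 → ℝ)).comp
      (ContinuousLinearMap.snd ℝ ℝ ((Fin 2 → ℝ) × (Fin 2 → ℝ))))).hasFDerivAt (x := z)
  have h := hO.add (HasFDerivAt.fun_sum (u := Finset.univ) fun Q _ => (hc Q).mul (hN Q))
  have h' : HasFDerivAt (redW ξ η M) _ z := h
  rw [h'.fderiv]
  simp [add_comm, mul_comm]

lemma Qcomp_comp_trunc (R M : Fin 2) (p : JetB) :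
    Qcomp (fun p => ξ (trunc p)) (fun L p => η L (trunc p)) R M p =
      fderiv ℝ (redM ξ η R M) (trunc p) (horizField ξ η (trunc p))
        - fderiv ℝ (redW ξ η M) (trunc p) (vertField ξ η R (trunc p)) := by
  have hM := (contDiff_redM hξ hη R M).differentiable (by simp)
  have hO := (contDiff_redO hξ hη M).differentiable (by simp)
  have hN := fun Q => (contDiff_redN hξ hη Q M).differentiable (by simp)
  rw [fderiv_redW_apply hξ hη]
  simp only [Qcomp, Mcomp_comp_trunc hξ hη, Ocomp_comp_trunc hξ hη, Ncomp_comp_trunc hξ hη,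
    pdX_comp_trunc hM, pdY_zero_comp_trunc hM, pdY_one_comp_trunc hM, pdY_one_comp_trunc hO,
    pdY_one_comp_trunc (hN _), horizField, vertField, map_eq_sum, redW, Fin.sum_univ_two]
  simp only [trunc, Pi.zero_apply]
  ring

end Reduced

lemma fderiv_fderiv_apply {F : JetOne → ℝ} (hF : ContDiff ℝ (⊤ : ℕ∞) F) {V : JetOne → JetOne}
    (hV : ContDiff ℝ (⊤ : ℕ∞) V) (z u : JetOne) :
    fderiv ℝ (fun z => fderiv ℝ F z (V z)) z u =
      fderiv ℝ (fderiv ℝ F) z u (V z) + fderiv ℝ F z (fderiv ℝ V z u) := by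
  have h1 : DifferentiableAt ℝ (fderiv ℝ F) z :=
    (hF.fderiv_right (m := (⊤ : ℕ∞)) (by simp)).differentiable (by simp) z
  have h2 : DifferentiableAt ℝ V z := hV.differentiable (by simp) z
  rw [fderiv_clm_apply h1 h2]
  simp [add_comm]

/-- If `W F = 0` and `W (V F) = 0` then `[V, W] F = 0`. -/
lemma fderiv_bracket_eq_zero {F : JetOne → ℝ} (hF : ContDiff ℝ (⊤ : ℕ∞) F)
    {V W : JetOne → JetOne} (hV : ContDiff ℝ (⊤ : ℕ∞) V) (hW : ContDiff ℝ (⊤ : ℕ∞) W)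
    (h1 : ∀ z, fderiv ℝ F z (W z) = 0)
    (h2 : ∀ z, fderiv ℝ (fun z => fderiv ℝ F z (V z)) z (W z) = 0) (z : JetOne) :
    fderiv ℝ F z (fderiv ℝ W z (V z) - fderiv ℝ V z (W z)) = 0 := by
  have e1 := fderiv_fderiv_apply hF hW z (V z)
  have e2 := fderiv_fderiv_apply hF hV z (W z)
  have e3 : fderiv ℝ (fun z => fderiv ℝ F z (W z)) z (V z) = 0 := by
    simp only [h1]
    simp
  have hs : fderiv ℝ (fderiv ℝ F) z (V z) (W z) = fderiv ℝ (fderiv ℝ F) z (W z) (V z) :=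
    (hF.contDiffAt.isSymmSndFDerivAt (by
      rw [minSmoothness_of_isRCLikeNormedField]
      exact WithTop.coe_le_coe.2 (le_top : (2 : ℕ∞) ≤ ⊤))) (V z) (W z)
  rw [map_sub]
  linarith [h2 z]

lemma trunc_extend (z : JetOne) : trunc (extend z) = z := by
  simp [trunc, extend]

end JetOne

lemma AdmissibleT.differentiable {F : ℝ → JetB → ℝ} (hF : AdmissibleT F) (p : JetB) :
    Differentiable ℝ fun t => F t p := by
  obtain ⟨S, g, hg, h⟩ := hF
  simp only [h]
  exact (hg.differentiable (by simp)).comp (by fun_prop)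

namespace IsFlowOf

open JetOne

lemma apply_apply {ξ : JetB → ℝ} {η0 : Fin 2 → JetB → ℝ} {Φ : ℝ → JetB → JetB}
    (hΦ : IsFlowOf ξ η0 Φ) (t s : ℝ) (p : JetB) : Φ t (Φ s p) = Φ (t + s) p :=
  congrFun (hΦ.2.2.2.1 s t) p

/-- If every `f ∘ Φ_s` has low order then so does the evolution of its time derivative. -/
lemma lowOrder_deriv_comp {ξ : JetB → ℝ} {η0 : Fin 2 → JetB → ℝ} {Φ : ℝ → JetB → JetB}
    (hΦ : IsFlowOf ξ η0 Φ) {f g : JetB → ℝ} (hf : ∀ s, LowOrder fun p => f (Φ s p))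
    (hg : ∀ p, deriv (fun t => f (Φ t p)) 0 = g p) (s : ℝ) :
    LowOrder fun p => g (Φ s p) := by
  intro p q h1 h2
  dsimp only
  rw [← hg, ← hg]
  congr 1
  ext t
  rw [hΦ.apply_apply, hΦ.apply_apply]
  exact hf _ p q h1 h2

variable {ξ : JetOne → ℝ} {η : Fin 2 → JetOne → ℝ} {Φ : ℝ → JetB → JetB}

lemma hasDerivAt_comp_trunc (hξ : ContDiff ℝ (⊤ : ℕ∞) ξ)
    (hη : ∀ L, ContDiff ℝ (⊤ : ℕ∞) (η L))
    (hΦ : IsFlowOf (fun p => ξ (trunc p)) (fun L p => η L (trunc p)) Φ)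
    {F : JetOne → ℝ} (hF : Differentiable ℝ F) (p : JetB) :
    HasDerivAt (fun t => F (trunc (Φ t p)))
      (fderiv ℝ F (trunc p) (horizField ξ η (trunc p))
        + ∑ R, p.2 (R, 2) * fderiv ℝ F (trunc p) (vertField ξ η R (trunc p))) 0 := by
  obtain ⟨hx, hy, h0, -, hdx, hdy⟩ := id hΦ
  have hX : HasDerivAt (fun t => (Φ t p).1) (ξ (trunc p)) 0 := by
    have h := (hx.differentiable p 0).hasDerivAt
    rwa [hdx p] at h
  have hY : ∀ L k, HasDerivAt (fun t => (Φ t p).2 (L, k))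
      (etaLB (fun p => ξ (trunc p)) (fun L p => η L (trunc p)) L k p) 0 := by
    intro L k
    have h := ((hy (L, k)).differentiable p 0).hasDerivAt
    rwa [hdy L k p] at h
  have hT := hX.prodMk ((hasDerivAt_pi.2 fun L => hY L 0).prodMk (hasDerivAt_pi.2 fun L => hY L 1))
  have hΦ0 : trunc (Φ 0 p) = trunc p := by rw [h0, id]
  have h := (hF (trunc (Φ 0 p))).hasFDerivAt.comp_hasDerivAt 0 hT
  rw [hΦ0] at h
  refine HasDerivAt.congr_deriv (f := fun t => F (trunc (Φ t p))) h ?_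
  simp only [map_eq_sum, etaLB_one_comp_trunc hξ hη, horizField, vertField,
    Fin.sum_univ_two, Pi.zero_apply]
  simp only [etaLB]
  ring

lemma fderiv_vertField_eq_zero (hξ : ContDiff ℝ (⊤ : ℕ∞) ξ)
    (hη : ∀ L, ContDiff ℝ (⊤ : ℕ∞) (η L))
    (hΦ : IsFlowOf (fun p => ξ (trunc p)) (fun L p => η L (trunc p)) Φ)
    {F : JetOne → ℝ} (hF : Differentiable ℝ F) (hlow : ∀ s, LowOrder fun p => F (trunc (Φ s p)))
    (R : Fin 2) (z : JetOne) : fderiv ℝ F z (vertField ξ η R z) = 0 := by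
  set p := extend z with hp
  have hpz : trunc p = z := trunc_extend z
  let q : JetB := (p.1, Function.update p.2 (R, 2) 1)
  have hpq : ∀ (L : Fin 2) (k : ℕ), k ≤ 1 → p.2 (L, k) = q.2 (L, k) := by
    intro L k hk
    have : k ≠ 2 := by lia
    simp [q, Function.update, this]
  have hqz : trunc q = z := by
    rw [← hpz]
    simp only [trunc, ← hpq _ 0 zero_le_one, ← hpq _ 1 le_rfl]
    rfl
  have e : (fun t => F (trunc (Φ t p))) = fun t => F (trunc (Φ t q)) :=
    funext fun t => hlow t p q rfl hpq
  have d := (hΦ.hasDerivAt_comp_trunc hξ hη hF p).unique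
    (e ▸ hΦ.hasDerivAt_comp_trunc hξ hη hF q)
  rw [hpz, hqz] at d
  have hp2 : ∀ K, p.2 (K, 2) = 0 := fun K => by simp [hp, extend]
  have hq2 : ∀ K, q.2 (K, 2) = if K = R then 1 else 0 := fun K => by
    simp [q, Function.update, hp2]
  simpa [hp2, hq2] using d

/-- The bracket of the two parts of the prolonged field annihilates every function whose
evolution under the flow has low order. -/
lemma sum_Qcomp_mul_eq_zero (hξ : ContDiff ℝ (⊤ : ℕ∞) ξ)
    (hη : ∀ L, ContDiff ℝ (⊤ : ℕ∞) (η L))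
    (hΦ : IsFlowOf (fun p => ξ (trunc p)) (fun L p => η L (trunc p)) Φ)
    (hξlow : ∀ s, LowOrder fun p => ξ (trunc (Φ s p)))
    (hηlow : ∀ L s, LowOrder fun p => η L (trunc (Φ s p)))
    {F : JetOne → ℝ} (hF : ContDiff ℝ (⊤ : ℕ∞) F)
    (hlow : ∀ s, LowOrder fun p => F (trunc (Φ s p))) (R : Fin 2) (p : JetB) :
    (∑ M, Qcomp (fun p => ξ (trunc p)) (fun L p => η L (trunc p)) R M p *
      pdY (M, 1) (fun p => F (trunc p)) p) = 0 := by
  have hFd := hF.differentiable (by simp)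
  have hV := contDiff_horizField hξ hη
  have hW := contDiff_vertField hξ hη R
  have hWF := fun R => hΦ.fderiv_vertField_eq_zero hξ hη hFd hlow R
  have hG : ContDiff ℝ (⊤ : ℕ∞) fun z => fderiv ℝ F z (horizField ξ η z) :=
    (hF.fderiv_right (by simp)).clm_apply hV
  have hGlow : ∀ s, LowOrder fun p =>
      fderiv ℝ F (trunc (Φ s p)) (horizField ξ η (trunc (Φ s p))) :=
    hΦ.lowOrder_deriv_comp (f := fun p => F (trunc p))
      (g := fun p => fderiv ℝ F (trunc p) (horizField ξ η (trunc p))) hlow fun p => by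
      simpa [hWF] using (hΦ.hasDerivAt_comp_trunc hξ hη hFd p).deriv
  have key := fderiv_bracket_eq_zero hF hV hW (hWF R)
    (hΦ.fderiv_vertField_eq_zero hξ hη (hG.differentiable (by simp)) hGlow R) (trunc p)
  set z := trunc p with hz
  have hWξ := hΦ.fderiv_vertField_eq_zero hξ hη (hξ.differentiable (by simp)) hξlow R z
  have hWη := fun L =>
    hΦ.fderiv_vertField_eq_zero hξ hη ((hη L).differentiable (by simp)) (hηlow L) R z
  have dV : HasFDerivAt (horizField ξ η)
      ((fderiv ℝ ξ z).prod ((ContinuousLinearMap.pi fun L => fderiv ℝ (η L) z).prod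
        (ContinuousLinearMap.pi fun L => fderiv ℝ (redW ξ η L) z))) z :=
    (hξ.differentiable (by simp) z).hasFDerivAt.prodMk
      ((hasFDerivAt_pi.2 fun L => ((hη L).differentiable (by simp) z).hasFDerivAt).prodMk
        (hasFDerivAt_pi.2 fun L =>
          ((contDiff_redW hξ hη L).differentiable (by simp) z).hasFDerivAt))
  have dW : HasFDerivAt (vertField ξ η R)
      ((0 : JetOne →L[ℝ] ℝ).prod ((0 : JetOne →L[ℝ] (Fin 2 → ℝ)).prod
        (ContinuousLinearMap.pi fun L => fderiv ℝ (redM ξ η R L) z))) z :=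
    (hasFDerivAt_const _ _).prodMk ((hasFDerivAt_const _ _).prodMk
        (hasFDerivAt_pi.2 fun L =>
          ((contDiff_redM hξ hη R L).differentiable (by simp) z).hasFDerivAt))
  have hb : fderiv ℝ (vertField ξ η R) z (horizField ξ η z)
      - fderiv ℝ (horizField ξ η) z (vertField ξ η R z) =
      (0, 0, fun M => Qcomp (fun p => ξ (trunc p)) (fun L p => η L (trunc p)) R M p) := by
    rw [dV.fderiv, dW.fderiv]
    refine Prod.ext ?_ (Prod.ext ?_ ?_)
    · simp [hWξ]
    · ext L
      simp [hWη]
    · ext L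
      simp [Qcomp_comp_trunc hξ hη, ← hz]
  rw [hb, map_eq_sum] at key
  simpa [pdY_one_comp_trunc hFd, ← hz] using key

lemma sum_Mcomp_mul_eq_zero (hξ : ContDiff ℝ (⊤ : ℕ∞) ξ)
    (hη : ∀ L, ContDiff ℝ (⊤ : ℕ∞) (η L))
    (hΦ : IsFlowOf (fun p => ξ (trunc p)) (fun L p => η L (trunc p)) Φ)
    {F : JetOne → ℝ} (hF : Differentiable ℝ F)
    (hlow : ∀ s, LowOrder fun p => F (trunc (Φ s p))) (R : Fin 2) (p : JetB) :
    (∑ M, Mcomp (fun p => ξ (trunc p)) (fun L p => η L (trunc p)) R M p *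
      pdY (M, 1) (fun p => F (trunc p)) p) = 0 := by
  have h := hΦ.fderiv_vertField_eq_zero hξ hη hF hlow R (trunc p)
  rw [vertField, map_eq_sum] at h
  simpa [pdY_one_comp_trunc hF, Mcomp_comp_trunc hξ hη] using h

end IsFlowOf

/-- Theorem 6, necessity: if the Lie–Bäcklund field on `J^∞(ℝ,ℝ²)`
with principal components `ξ, η^0_1, η^0_2` depending only on
`(x, y^0_1, y^0_2, y^1_1, y^1_2)` is exponentiable to a flow whose components `Ξ_t`
and `H^0_{L,t}` do not depend on the coordinates `y^γ_M` with `γ ≥ 2`, then the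
identities (i) and (ii) hold. -/
theorem theorem6_necessity (ξ : JetB → ℝ) (η0 : Fin 2 → JetB → ℝ)
    (hξadm : Admissible ξ) (hη0adm : ∀ L, Admissible (η0 L))
    (hξlow : LowOrder ξ) (hη0low : ∀ L, LowOrder (η0 L))
    (Φ : ℝ → JetB → JetB) (hΦ : IsFlowOf ξ η0 Φ)
    (hΞlow : ∀ t : ℝ, LowOrder fun p => (Φ t p).1)
    (hHlow : ∀ (t : ℝ) (L : Fin 2), LowOrder fun p => (Φ t p).2 (L, 0)) :
    (∀ (R L : Fin 2) (p : JetB),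
        (∑ M, Mcomp ξ η0 R M p * pdY (M, 1) ξ p) = 0 ∧
        (∑ M, Mcomp ξ η0 R M p * pdY (M, 1) (η0 L) p) = 0) ∧
    (∀ (R L : Fin 2) (p : JetB),
        (∑ M, Qcomp ξ η0 R M p * pdY (M, 1) ξ p) = 0 ∧
        (∑ M, Qcomp ξ η0 R M p * pdY (M, 1) (η0 L) p) = 0) := by
  obtain ⟨ξ', hξ', rfl⟩ := JetOne.exists_eq_comp_trunc hξadm hξlow
  choose η' hη' hη using fun L => JetOne.exists_eq_comp_trunc (hη0adm L) (hη0low L)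
  obtain rfl : η0 = fun L p => η' L (JetOne.trunc p) := funext hη
  have hξs := hΦ.lowOrder_deriv_comp (f := fun p => p.1) hΞlow hΦ.2.2.2.2.1
  have hηs := fun L => hΦ.lowOrder_deriv_comp (f := fun p => p.2 (L, 0)) (fun t => hHlow t L)
    (hΦ.2.2.2.2.2 L 0)
  have hηs' : ∀ L s, LowOrder fun p => η' L (JetOne.trunc (Φ s p)) := hηs
  exact ⟨fun R L p =>
      ⟨hΦ.sum_Mcomp_mul_eq_zero hξ' hη' (hξ'.differentiable (by simp)) hξs R p,
        hΦ.sum_Mcomp_mul_eq_zero hξ' hη' ((hη' L).differentiable (by simp)) (hηs' L) R p⟩,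
    fun R L p =>
      ⟨hΦ.sum_Qcomp_mul_eq_zero hξ' hη' hξs hηs' hξ' hξs R p,
        hΦ.sum_Qcomp_mul_eq_zero hξ' hη' hξs hηs' (hη' L) (hηs' L) R p⟩⟩
end

section
/- (Theorem, sufficiency) Let X be the Lie–Bäcklund field on J^∞(ℝ,ℝ²) determined by admissible principal components ξ, η^0_1, η^0_2 that depend only on the coordinates (x, y^0_1, y^0_2, y^1_1, y^1_2). Suppose the matrix (M^Q_L) is nonzero at a point P = (x̄, ȳ^0_1, ȳ^0_2, ȳ^1_1, ȳ^1_2) and that the following identities hold on the domain: (i) Σ_{M=1}^{2} M^R_M ∂ξ/∂y^1_M = 0 and Σ_{M=1}^{2} M^R_M ∂η^0_L/∂y^1_M = 0 for all L, R ∈ {1,2}; and (ii) Σ_{M=1}^{2} Q^R_M ∂ξ/∂y^1_M = 0 and Σ_{M=1}^{2} Q^R_M ∂η^0_L/∂y^1_M = 0 for all L, R ∈ {1,2}. Then X is exponentiable to a local flow Φ_t = (Ξ_t, H^α_{L,t}), defined on a subset of J^∞(ℝ,ℝ²) projecting onto a neighborhood of P, whose components Ξ_t and H^0_{L,t} do not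 depend on any coordinate y^γ_M with γ ≥ 2. -/
open scoped BigOperators

/-- `F t` is, for `t ∈ I` and on `W`, a `C^∞` function of `t` and finitely many
coordinates, the finite set of relevant coordinates being independent of `t`. -/
def AdmissibleTOn (I : Set ℝ) (W : Set JetB) (F : ℝ → JetB → ℝ) : Prop :=
  ∃ (S : Finset (Fin 2 × ℕ)) (U : Set (ℝ × ℝ × (↥S → ℝ)))
    (g : ℝ × ℝ × (↥S → ℝ) → ℝ),
    IsOpen U ∧ ContDiffOn ℝ (⊤ : ℕ∞) g U ∧
    ∀ t ∈ I, ∀ p ∈ W, (t, p.1, fun a => p.2 a.1) ∈ U ∧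
      F t p = g (t, p.1, fun a => p.2 a.1)

/-- `Φ` is a local flow (for times in `(-δ,δ)`, on the set `W`) exponentiating the
Lie–Bäcklund field with principal components `ξ, η0` on `J^∞(ℝ,ℝ²)`. -/
def IsLocalFlowOf (ξ : JetB → ℝ) (η0 : Fin 2 → JetB → ℝ) (W : Set JetB) (δ : ℝ)
    (Φ : ℝ → JetB → JetB) : Prop :=
  AdmissibleTOn (Set.Ioo (-δ) δ) W (fun t p => (Φ t p).1) ∧
  (∀ q : Fin 2 × ℕ, AdmissibleTOn (Set.Ioo (-δ) δ) W fun t p => (Φ t p).2 q) ∧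
  (∀ p ∈ W, Φ 0 p = p) ∧
  (∀ s ∈ Set.Ioo (-δ) δ, ∀ t ∈ Set.Ioo (-δ) δ, t + s ∈ Set.Ioo (-δ) δ →
    ∀ p ∈ W, Φ s p ∈ W → Φ t (Φ s p) = Φ (t + s) p) ∧
  (∀ p ∈ W, HasDerivAt (fun t => (Φ t p).1) (ξ p) 0) ∧
  (∀ (L : Fin 2) (k : ℕ), ∀ p ∈ W,
    HasDerivAt (fun t => (Φ t p).2 (L, k)) (etaLB ξ η0 L k p) 0)

/-- `F` depends, on `W`, only on the coordinates `(x, y^0_1, y^0_2, y^1_1, y^1_2)`. -/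
def LowOrderOn (W : Set JetB) (F : JetB → ℝ) : Prop :=
  ∀ p ∈ W, ∀ q ∈ W, p.1 = q.1 →
    (∀ (L : Fin 2) (k : ℕ), k ≤ 1 → p.2 (L, k) = q.2 (L, k)) → F p = F q

/-- Projection of `J^∞(ℝ,ℝ²)` onto the first-order coordinates
`(x, (y^0_1, y^0_2), (y^1_1, y^1_2))`. -/
def proj1 (p : JetB) : ℝ × (Fin 2 → ℝ) × (Fin 2 → ℝ) :=
  (p.1, fun L => p.2 (L, 0), fun L => p.2 (L, 1))

section JetFlows

open Set Filter Topology
open scoped ContDiff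

section Nemytskii

universe u

/-- Pointwise application of a continuous family of continuous linear maps, as a continuous
bilinear map on spaces of continuous functions. -/
noncomputable def pointwiseApplyCLM (X : Type*) [TopologicalSpace X] [CompactSpace X]
    (E F : Type*) [NormedAddCommGroup E] [NormedSpace ℝ E]
    [NormedAddCommGroup F] [NormedSpace ℝ F] :
    C(X, E →L[ℝ] F) →L[ℝ] C(X, E) →L[ℝ] C(X, F) :=
  LinearMap.mkContinuous₂
    (LinearMap.mk₂ ℝ (fun (A : C(X, E →L[ℝ] F)) (h : C(X, E)) =>
        (⟨fun x => A x (h x), by fun_prop⟩ : C(X, F)))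
      (fun _ _ _ => by ext; simp) (fun _ _ _ => by ext; simp)
      (fun _ _ _ => by ext; simp) (fun _ _ _ => by ext; simp)) 1 (by
    intro A h
    rw [one_mul]
    refine (ContinuousMap.norm_le _ (mul_nonneg (norm_nonneg A) (norm_nonneg h))).2 ?_
    intro x
    exact (A x).le_of_opNorm_le_of_le (A.norm_coe_le_norm x) (h.norm_coe_le_norm x))

variable {X : Type*} [TopologicalSpace X] [CompactSpace X]

theorem hasFDerivAt_continuousMap_comp {E F : Type*} [NormedAddCommGroup E] [NormedSpace ℝ E]
    [NormedAddCommGroup F] [NormedSpace ℝ F] (f : C(E, F)) (hf : Differentiable ℝ f)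
    (f' : C(E, E →L[ℝ] F)) (hf' : ⇑f' = fderiv ℝ f) (α : C(X, E)) :
    HasFDerivAt (fun β : C(X, E) => f.comp β) (pointwiseApplyCLM X E F (f'.comp α)) α := by
  rw [hasFDerivAt_iff_isLittleO_nhds_zero, Asymptotics.isLittleO_iff]
  intro ε hε
  have hc : Continuous fun β : C(X, E) => f'.comp β := ContinuousMap.continuous_postcomp _
  have hca := hc.continuousAt (x := α)
  obtain ⟨δ, hδ, hball⟩ := (Metric.continuousAt_iff (α := C(X, E)) (β := C(X, E →L[ℝ] F))).1 hca ε hε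
  filter_upwards [Metric.ball_mem_nhds (0 : C(X, E)) hδ] with h hh
  rw [mem_ball_zero_iff] at hh
  rw [ContinuousMap.norm_le _ (by positivity)]
  intro x
  have key : ‖f (α x + h x) - f (α x) - f' (α x) (α x + h x - α x)‖
      ≤ ε * ‖α x + h x - α x‖ := by
    refine (convex_segment (α x) (α x + h x)).norm_image_sub_le_of_norm_hasFDerivWithin_le'
      (f' := fun y => fderiv ℝ f y) (fun y _ => (hf y).hasFDerivAt.hasFDerivWithinAt) ?_
      (left_mem_segment _ _ _) (right_mem_segment _ _ _)
    rintro y hy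
    rw [segment_eq_image'] at hy
    obtain ⟨θ, hθ, rfl⟩ := hy
    have hd := hball (x := α + θ • h) (by
      rw [dist_eq_norm, add_sub_cancel_left, norm_smul, Real.norm_of_nonneg hθ.1]
      nlinarith [hθ.2, norm_nonneg h])
    have := (ContinuousMap.dist_apply_le_dist x).trans hd.le
    simpa [dist_eq_norm, hf'] using this
  simp only [add_sub_cancel_left] at key
  exact key.trans (by gcongr; exact h.norm_coe_le_norm x)

theorem contDiff_continuousMap_comp_nat {E : Type u} [NormedAddCommGroup E] [NormedSpace ℝ E]
    (n : ℕ) : ∀ {F : Type u} [NormedAddCommGroup F] [NormedSpace ℝ F] (f : C(E, F)),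
      ContDiff ℝ (n + 1) f → ContDiff ℝ n (fun β : C(X, E) => f.comp β) := by
  induction n with
  | zero =>
    intro F _ _ f _
    rw [Nat.cast_zero, contDiff_zero]
    exact ContinuousMap.continuous_postcomp _
  | succ n ih =>
    intro F _ _ f hf
    push_cast at hf ⊢
    have hf1 := contDiff_succ_iff_fderiv.1 hf
    have hd := hasFDerivAt_continuousMap_comp (X := X) f hf1.1
      ⟨fderiv ℝ f, hf1.2.2.continuous⟩ rfl
    refine contDiff_succ_iff_fderiv.2 ⟨fun α => (hd α).differentiableAt, by simp, ?_⟩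
    rw [show fderiv ℝ (fun β : C(X, E) => f.comp β) = _ from funext fun α => (hd α).fderiv]
    exact (pointwiseApplyCLM X E F).contDiff.comp
      (ih ⟨fderiv ℝ f, hf1.2.2.continuous⟩ hf1.2.2)

theorem contDiff_continuousMap_comp {E F : Type u} [NormedAddCommGroup E] [NormedSpace ℝ E]
    [NormedAddCommGroup F] [NormedSpace ℝ F] (f : C(E, F)) (hf : ContDiff ℝ ∞ f) :
    ContDiff ℝ ∞ (fun β : C(X, E) => f.comp β) :=
  contDiff_infty.2 fun n =>
    contDiff_continuousMap_comp_nat n f (hf.of_le (by exact_mod_cast le_top))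

end Nemytskii

section InverseFunction

variable {E F : Type*} [NormedAddCommGroup E] [NormedSpace ℝ E] [CompleteSpace E]
  [NormedAddCommGroup F] [NormedSpace ℝ F]

/-- The inverse function theorem for a `C^∞` map, with an inverse which is `C^∞` on a
neighbourhood and not only at the base point. -/
theorem ContDiff.exists_openPartialHomeomorph {f : E → F} (hf : ContDiff ℝ ∞ f) {a : E}
    {f' : E ≃L[ℝ] F} (hf' : HasFDerivAt f (f' : E →L[ℝ] F) a) :
    ∃ e : OpenPartialHomeomorph E F, (e : E → F) = f ∧ a ∈ e.source ∧
      ContDiffOn ℝ ∞ e.symm e.target := by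
  have h0 : (∞ : WithTop ℕ∞) ≠ 0 := by simp
  let e := hf.contDiffAt.toOpenPartialHomeomorph f hf' h0
  have hinv : IsOpen {x | fderiv ℝ f x ∈ range ((↑) : (E ≃L[ℝ] F) → E →L[ℝ] F)} :=
    ContinuousLinearEquiv.isOpen.preimage (hf.continuous_fderiv h0)
  have hea : a ∈ e.source := hf.contDiffAt.mem_toOpenPartialHomeomorph_source hf' h0
  refine ⟨e.restrOpen _ hinv, rfl, ⟨hea, f', hf'.fderiv.symm⟩, ?_⟩
  intro y hy
  obtain ⟨g', hg'⟩ := ((e.restrOpen _ hinv).map_target hy).2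
  refine ((e.restrOpen _ hinv).contDiffAt_symm hy (f₀' := g') ?_
    hf.contDiffAt).contDiffWithinAt
  have := (hf.differentiable h0 ((e.restrOpen _ hinv).symm y)).hasFDerivAt
  rw [← show _ = fderiv ℝ f _ from hg'] at this
  exact this

end InverseFunction

section Flow

variable {E : Type*} [NormedAddCommGroup E]

/-- The extension of a curve on `[-2, 2]` to `ℝ` by its end values. -/
noncomputable def extendCurve (α : C(Icc (-2 : ℝ) 2, E)) : ℝ → E :=
  IccExtend (by norm_num : (-2 : ℝ) ≤ 2) α

theorem continuous_extendCurve (α : C(Icc (-2 : ℝ) 2, E)) : Continuous (extendCurve α) :=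
  α.continuous.Icc_extend'

theorem extendCurve_of_mem (α : C(Icc (-2 : ℝ) 2, E)) {t : ℝ} (ht : t ∈ Icc (-2 : ℝ) 2) :
    extendCurve α t = α ⟨t, ht⟩ := IccExtend_of_mem _ _ ht

variable [NormedSpace ℝ E]

/-- Integration from `0` as an operator on curves on `[-2, 2]`. -/
noncomputable def volterraCLM (E : Type*) [NormedAddCommGroup E] [NormedSpace ℝ E] :
    C(Icc (-2 : ℝ) 2, E) →L[ℝ] C(Icc (-2 : ℝ) 2, E) :=
  LinearMap.mkContinuous
    { toFun := fun α => ⟨fun t => ∫ s in (0 : ℝ)..t, extendCurve α s,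
        (intervalIntegral.continuous_primitive
          (fun _ _ => (continuous_extendCurve α).intervalIntegrable _ _) 0).comp
          continuous_subtype_val⟩
      map_add' := fun α β => by
        ext t
        exact intervalIntegral.integral_add
          ((continuous_extendCurve α).intervalIntegrable _ _)
          ((continuous_extendCurve β).intervalIntegrable _ _)
      map_smul' := fun c α => by
        ext t
        exact intervalIntegral.integral_smul c (extendCurve α) } 2 (by
    intro α
    refine (ContinuousMap.norm_le _ (by positivity)).2 fun t => ?_
    have h := intervalIntegral.norm_integral_le_of_norm_le_const (a := 0) (b := (t : ℝ))
      (f := extendCurve α) (C := ‖α‖) fun s _ => α.norm_coe_le_norm _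
    have ht : |(t : ℝ) - 0| ≤ 2 := by rw [sub_zero, abs_le]; exact t.2
    refine h.trans ?_
    rw [mul_comm]
    gcongr)

variable [CompleteSpace E]

/-- Solutions of the rescaled integral equation solve the rescaled differential equation. -/
theorem hasDerivAt_extendCurve_of_integral_eq {f : E → E} (hf : Continuous f) {l : ℝ} {x : E}
    {α : C(Icc (-2 : ℝ) 2, E)}
    (h : α = ContinuousMap.const _ x + l • volterraCLM E ((⟨f, hf⟩ : C(E, E)).comp α)) :
    extendCurve α 0 = x ∧ ∀ t ∈ Ioo (-2 : ℝ) 2,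
      HasDerivAt (extendCurve α) (l • f (extendCurve α t)) t := by
  have hval : ∀ t ∈ Icc (-2 : ℝ) 2,
      extendCurve α t = x + l • ∫ s in (0 : ℝ)..t, f (extendCurve α s) := by
    intro t ht
    rw [extendCurve_of_mem α ht]
    conv_lhs => rw [h]
    rfl
  refine ⟨by simpa using hval 0 (by norm_num), fun t ht => ?_⟩
  have hc : Continuous fun s => f (extendCurve α s) := hf.comp (continuous_extendCurve α)
  have hd := ((hc.integral_hasStrictDerivAt 0 t).hasDerivAt.const_smul l).const_add x
  refine hd.congr_of_eventuallyEq ?_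
  filter_upwards [Ioo_mem_nhds ht.1 ht.2] with s hs
  exact hval s (Ioo_subset_Icc_self hs)

end Flow

section FlowExists

universe u

variable {E : Type u} [NormedAddCommGroup E] [NormedSpace ℝ E] [CompleteSpace E]

/-- Near the constant curves, solutions of the rescaled integral equation depend smoothly on the
scale and on the initial value. -/
theorem exists_smooth_family_integral_eq {f : E → E} (hf : ContDiff ℝ ∞ f) (x₀ : E) :
    ∃ U : Set (ℝ × E), IsOpen U ∧ ((0 : ℝ), x₀) ∈ U ∧
      ∃ A : ℝ × E → C(Icc (-2 : ℝ) 2, E), ContDiffOn ℝ ∞ A U ∧ ∀ a ∈ U,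
        A a = ContinuousMap.const _ a.2 +
          a.1 • volterraCLM E ((⟨f, hf.continuous⟩ : C(E, E)).comp (A a)) := by
  let C := C(Icc (-2 : ℝ) 2, E)
  let N : C → C := fun α => (⟨f, hf.continuous⟩ : C(E, E)).comp α
  have hN : ContDiff ℝ ∞ N := contDiff_continuousMap_comp _ hf
  let cst : E →L[ℝ] C := ContinuousLinearMap.const ℝ _
  let Ψ : (ℝ × E) × C → (ℝ × E) × C := fun z =>
    (z.1, z.2 - cst z.1.2 - z.1.1 • volterraCLM E (N z.2))
  have hΨ : ContDiff ℝ ∞ Ψ := by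
    refine contDiff_fst.prodMk ((contDiff_snd.sub (cst.contDiff.comp contDiff_fst.snd)).sub ?_)
    exact contDiff_fst.fst.smul ((volterraCLM E).contDiff.comp (hN.comp contDiff_snd))
  let a₀ : (ℝ × E) × C := ((0, x₀), cst x₀)
  let w : C := volterraCLM E (N (cst x₀))
  let L : ℝ × E →L[ℝ] C := -(cst.comp (ContinuousLinearMap.snd ℝ ℝ E)) -
    (ContinuousLinearMap.fst ℝ ℝ E).smulRight w
  let Ψ' : ((ℝ × E) × C) ≃L[ℝ] (ℝ × E) × C :=
    (ContinuousLinearEquiv.refl ℝ (ℝ × E)).skewProd (ContinuousLinearEquiv.refl ℝ C) L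
  have hΨ' : HasFDerivAt Ψ (Ψ' : (ℝ × E) × C →L[ℝ] (ℝ × E) × C) a₀ := by
    have hV : HasFDerivAt (fun z : (ℝ × E) × C => volterraCLM E (N z.2)) _ a₀ :=
      (((volterraCLM E).contDiff.comp (hN.comp contDiff_snd)).differentiable
        (by simp) a₀).hasFDerivAt
    have h1 : HasFDerivAt (fun z : (ℝ × E) × C => z.1) (ContinuousLinearMap.fst ℝ (ℝ × E) C) a₀ :=
      hasFDerivAt_fst
    have h2 : HasFDerivAt (fun z : (ℝ × E) × C => z.2) (ContinuousLinearMap.snd ℝ (ℝ × E) C) a₀ :=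
      hasFDerivAt_snd
    refine (h1.prodMk ((h2.sub (cst.hasFDerivAt.comp a₀ h1.snd)).sub
      (h1.fst.smul hV))).congr_fderiv ?_
    refine ContinuousLinearMap.ext fun z => Prod.ext rfl ?_
    change z.2 - cst z.1.2 - ((0 : ℝ) • _ + z.1.1 • w) = z.2 + (-cst z.1.2 - z.1.1 • w)
    rw [zero_smul]
    abel
  obtain ⟨e, he, hea, hsymm⟩ := hΨ.exists_openPartialHomeomorph hΨ'
  have hea' : ((0, x₀), (0 : C)) ∈ e.target := by
    have : e a₀ = ((0, x₀), (0 : C)) := by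
      rw [he]
      refine Prod.ext rfl ?_
      change cst x₀ - cst x₀ - (0 : ℝ) • w = 0
      rw [zero_smul, sub_self, sub_zero]
    exact this ▸ e.map_source hea
  let j : ℝ × E → (ℝ × E) × C := fun a => (a, 0)
  have hj : ContDiff ℝ ∞ j := contDiff_id.prodMk contDiff_const
  refine ⟨j ⁻¹' e.target, e.open_target.preimage hj.continuous, hea',
    fun a => (e.symm (j a)).2, ?_, fun a ha => ?_⟩
  · exact contDiff_snd.comp_contDiffOn (hsymm.comp hj.contDiffOn fun _ h => h)
  · have h := e.right_inv ha
    rw [he] at h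
    have h1 : (e.symm (j a)).1 = a := congrArg Prod.fst h
    have h2 : (e.symm (j a)).2 - cst (e.symm (j a)).1.2 -
        (e.symm (j a)).1.1 • volterraCLM E (N (e.symm (j a)).2) = 0 := congrArg Prod.snd h
    rw [h1, sub_sub, sub_eq_zero] at h2
    exact h2

/-- Local existence, uniqueness and smooth dependence on the initial value for the flow of a
globally Lipschitz smooth vector field. -/
theorem exists_smooth_local_flow {f : E → E} (hf : ContDiff ℝ ∞ f) {K : NNReal}
    (hK : LipschitzWith K f) (x₀ : E) :
    ∃ δ : ℝ, 0 < δ ∧ ∃ U : Set E, IsOpen U ∧ x₀ ∈ U ∧ ∃ ψ : ℝ × E → E,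
      ContDiffOn ℝ ∞ ψ (Ioo (-δ) δ ×ˢ U) ∧ (∀ x ∈ U, ψ (0, x) = x) ∧
      ∀ x ∈ U, ∀ t ∈ Ioo (-δ) δ, HasDerivAt (fun s => ψ (s, x)) (f (ψ (t, x))) t := by
  obtain ⟨V, hVo, hV, A, hA, hAeq⟩ := exists_smooth_family_integral_eq hf x₀
  obtain ⟨I, hI, U, hU, hIU⟩ := mem_nhds_prod_iff.1 (hVo.mem_nhds hV)
  obtain ⟨ε, hε, hεI⟩ := Metric.mem_nhds_iff.1 hI
  obtain ⟨U', hU'U, hU'o, hxU'⟩ := mem_nhds_iff.1 hU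
  have h1 : (1 : ℝ) ∈ Icc (-2 : ℝ) 2 := by norm_num
  have hmem : ∀ t ∈ Ioo (-ε) ε, ∀ x ∈ U', (t, x) ∈ V := fun t ht x hx =>
    hIU ⟨hεI (by rw [Real.ball_eq_Ioo]; simpa using ht), hU'U hx⟩
  have hsol := fun (t : ℝ) (ht : t ∈ Ioo (-ε) ε) (x : E) (hx : x ∈ U') =>
    hasDerivAt_extendCurve_of_integral_eq hf.continuous (hAeq _ (hmem t ht x hx))
  have hε2 : ε / 2 ∈ Ioo (-ε) ε := ⟨by linarith, by linarith⟩
  have hresc : ∀ x ∈ U', ∀ t ∈ Ioo (-(ε / 2)) (ε / 2),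
      extendCurve (A (t, x)) 1 = extendCurve (A (ε / 2, x)) (2 / ε * t) := by
    intro x hx t ht
    have ht' : t ∈ Ioo (-ε) ε := ⟨by linarith [ht.1], by linarith [ht.2]⟩
    have hr : |2 / ε * t| ≤ 1 := by
      rw [abs_mul, abs_of_pos (by positivity), div_mul_eq_mul_div, div_le_one hε]
      linarith [abs_lt.2 ht]
    have hrr := abs_le.1 hr
    have := ODE_solution_unique_of_mem_Ioo (v := fun _ y => t • f y) (s := fun _ => univ)
      (K := ‖t‖₊ * K) (t₀ := 0) (a := -2) (b := 2) (f := extendCurve (A (t, x)))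
      (g := fun s => extendCurve (A (ε / 2, x)) (2 / ε * t * s))
      (fun _ _ => by
        refine LipschitzWith.lipschitzOnWith ?_
        refine LipschitzWith.of_dist_le_mul fun y z => ?_
        rw [dist_smul₀, NNReal.coe_mul, mul_assoc]
        exact mul_le_mul_of_nonneg_left (hK.dist_le_mul y z) (norm_nonneg _))
      (by norm_num) (fun s hs => ⟨(hsol t ht' x hx).2 s hs, mem_univ _⟩)
      (fun s hs => ⟨?_, mem_univ _⟩)
      (by simp [(hsol t ht' x hx).1, (hsol _ hε2 x hx).1])
    · simpa using this (show (1 : ℝ) ∈ Ioo (-2 : ℝ) 2 by norm_num)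
    · have hs' : 2 / ε * t * s ∈ Ioo (-2 : ℝ) 2 := by
        refine abs_lt.1 ?_
        rw [abs_mul]
        have := abs_lt.2 hs
        nlinarith [abs_nonneg s, abs_nonneg (2 / ε * t)]
      have hd := ((hsol _ hε2 x hx).2 _ hs').scomp s ((hasDerivAt_id s).const_mul (2 / ε * t))
      refine hd.congr_deriv ?_
      rw [smul_smul]
      congr 1
      field_simp
  refine ⟨ε / 2, by positivity, U', hU'o, hxU', fun a => extendCurve (A a) 1, ?_, ?_, ?_⟩
  · have : ContDiffOn ℝ ∞ (fun a => ContinuousMap.evalCLM ℝ (⟨1, h1⟩ : Icc (-2 : ℝ) 2) (A a))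
        (Ioo (-(ε / 2)) (ε / 2) ×ˢ U') :=
      (ContinuousLinearMap.contDiff _).comp_contDiffOn (hA.mono fun a ha =>
        hmem a.1 ⟨by linarith [ha.1.1], by linarith [ha.1.2]⟩ a.2 ha.2)
    exact this.congr fun a _ => extendCurve_of_mem _ h1
  · intro x hx
    simp [hresc x hx 0 (by constructor <;> linarith), (hsol _ hε2 x hx).1]
  · intro x hx t ht
    have ht2 : 2 / ε * t ∈ Ioo (-2 : ℝ) 2 := by
      refine abs_lt.1 ?_
      rw [abs_mul, abs_of_pos (by positivity), div_mul_eq_mul_div, div_lt_iff₀ hε]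
      linarith [abs_lt.2 ht]
    have hd := ((hsol _ hε2 x hx).2 _ ht2).scomp t ((hasDerivAt_id t).const_mul (2 / ε))
    refine (hd.congr_deriv ?_).congr_of_eventuallyEq ?_
    · rw [smul_smul, ← hresc x hx t ht, show 2 / ε * 1 * (ε / 2, x).1 = 1 by field_simp, one_smul]
    · filter_upwards [Ioo_mem_nhds ht.1 ht.2] with s hs
      simpa using hresc x hx s hs

end FlowExists

section SecondDerivative

variable {A B : Type*} [NormedAddCommGroup A] [NormedSpace ℝ A]
  [NormedAddCommGroup B] [NormedSpace ℝ B]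

/-- The derivative of `v`-derivatives along `u` equals the derivative of `u`-derivatives
along `v`. -/
theorem ContDiffAt.hasDerivAt_fderiv_swap {g : A → B} {a u v : A} {n : WithTop ℕ∞}
    (hg : ContDiffAt ℝ n g a) (hn : 2 ≤ n) {c d : ℝ → A} {t r : ℝ} (hc : HasDerivAt c u t)
    (hct : c t = a) (hd : HasDerivAt d v r) (hdr : d r = a) :
    HasDerivAt (fun s => fderiv ℝ g (c s) v) (deriv (fun s => fderiv ℝ g (d s) u) r) t := by
  have h1 : DifferentiableAt ℝ (fderiv ℝ g) a :=
    (hg.fderiv_right (m := 1) hn).differentiableAt one_ne_zero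
  have hsymm : IsSymmSndFDerivAt ℝ g a := hg.isSymmSndFDerivAt (by simpa using hn)
  have hcomp : ∀ {e : ℝ → A} {w z : A} {τ : ℝ}, HasDerivAt e w τ → e τ = a →
      HasDerivAt (fun s => fderiv ℝ g (e s) z) (fderiv ℝ (fderiv ℝ g) a w z) τ := by
    intro e w z τ he heτ
    have h2 : HasFDerivAt (fderiv ℝ g) (fderiv ℝ (fderiv ℝ g) a) (e τ) := by
      rw [heτ]
      exact h1.hasFDerivAt
    simpa using (h2.comp_hasDerivAt τ he).clm_apply (hasDerivAt_const τ z)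
  rw [(hcomp hd hdr).deriv, hsymm v u]
  exact hcomp hc hct

end SecondDerivative

section FlowProperties

variable {E : Type*} [NormedAddCommGroup E] [NormedSpace ℝ E]

/-- The group property of a local flow. -/
theorem flow_add {f : E → E} {K : NNReal} (hK : LipschitzWith K f) {δ : ℝ} {U : Set E}
    {ψ : ℝ × E → E} (h0 : ∀ x ∈ U, ψ (0, x) = x)
    (hψ : ∀ x ∈ U, ∀ t ∈ Ioo (-δ) δ, HasDerivAt (fun s => ψ (s, x)) (f (ψ (t, x))) t)
    {x : E} (hx : x ∈ U) {s t : ℝ} (hs : s ∈ Ioo (-δ) δ) (ht : t ∈ Ioo (-δ) δ)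
    (hts : t + s ∈ Ioo (-δ) δ) (hxs : ψ (s, x) ∈ U) : ψ (t, ψ (s, x)) = ψ (t + s, x) := by
  have hδ : 0 < δ := by linarith [hs.1, hs.2]
  have h := ODE_solution_unique_of_mem_Ioo (v := fun _ y => f y) (s := fun _ => univ)
    (K := K) (t₀ := 0) (a := max (-δ) (-δ - s)) (b := min δ (δ - s))
    (f := fun τ => ψ (τ, ψ (s, x))) (g := fun τ => ψ (τ + s, x))
    (fun _ _ => hK.lipschitzOnWith)
    ⟨by simp [hδ]; linarith [hs.1], by simp [hδ]; linarith [hs.2]⟩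
    (fun τ hτ => ⟨hψ _ hxs τ ⟨(max_lt_iff.1 hτ.1).1, (lt_min_iff.1 hτ.2).1⟩, mem_univ _⟩)
    (fun τ hτ => ⟨(hψ x hx (τ + s) ⟨by linarith [(max_lt_iff.1 hτ.1).2],
      by linarith [(lt_min_iff.1 hτ.2).2]⟩).comp_add_const τ s, mem_univ _⟩)
    (by simp [h0 _ hxs])
  exact h ⟨max_lt ht.1 (by linarith [hts.1]), lt_min ht.2 (by linarith [hts.2])⟩

/-- The first variation of a flow satisfies the linearised equation. -/
theorem hasDerivAt_fderiv_flow {f : E → E} (hf : Differentiable ℝ f) {δ : ℝ} {U : Set E}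
    (hU : IsOpen U) {ψ : ℝ × E → E} (hψs : ContDiffOn ℝ ∞ ψ (Ioo (-δ) δ ×ˢ U))
    (hψ : ∀ x ∈ U, ∀ t ∈ Ioo (-δ) δ, HasDerivAt (fun s => ψ (s, x)) (f (ψ (t, x))) t)
    {x : E} (hx : x ∈ U) {t : ℝ} (ht : t ∈ Ioo (-δ) δ) (h : E) :
    HasDerivAt (fun s => fderiv ℝ ψ (s, x) (0, h))
      (fderiv ℝ f (ψ (t, x)) (fderiv ℝ ψ (t, x) (0, h))) t := by
  have hmem : ∀ {s y}, s ∈ Ioo (-δ) δ → y ∈ U → Ioo (-δ) δ ×ˢ U ∈ 𝓝 (s, y) := fun hs hy =>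
    (isOpen_Ioo.prod hU).mem_nhds ⟨hs, hy⟩
  have hψd : ∀ {s y}, s ∈ Ioo (-δ) δ → y ∈ U → HasFDerivAt ψ (fderiv ℝ ψ (s, y)) (s, y) :=
    fun hs hy => ((hψs.contDiffAt (hmem hs hy)).differentiableAt (by simp)).hasFDerivAt
  have hline : HasDerivAt (fun τ : ℝ => (t, x + τ • h)) ((0 : ℝ), h) 0 := by
    refine (hasDerivAt_const _ _).prodMk ?_
    simpa using ((hasDerivAt_id (0 : ℝ)).smul_const h).const_add x
  have key := (hψs.contDiffAt (hmem ht hx)).hasDerivAt_fderiv_swap (v := ((0 : ℝ), h))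
    (u := ((1 : ℝ), (0 : E))) (WithTop.coe_le_coe.2 le_top)
    ((hasDerivAt_id t).prodMk (hasDerivAt_const t x)) rfl hline (by simp)
  refine key.congr_deriv ?_
  have hnear : ∀ᶠ τ : ℝ in 𝓝 0, x + τ • h ∈ U := by
    have hc : ContinuousAt (fun τ : ℝ => x + τ • h) 0 := by fun_prop
    exact hc.eventually (hU.mem_nhds (by simpa using hx))
  have hev : (fun τ : ℝ => fderiv ℝ ψ (t, x + τ • h) (1, 0)) =ᶠ[𝓝 0]
      fun τ => f (ψ (t, x + τ • h)) := by
    filter_upwards [hnear] with τ hτ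
    have := HasFDerivAt.comp_hasDerivAt (f := fun s : ℝ => (s, x + τ • h)) t (hψd ht hτ)
      ((hasDerivAt_id t).prodMk (hasDerivAt_const t _))
    exact this.unique (hψ _ hτ t ht)
  rw [hev.deriv_eq]
  have h1 : HasDerivAt (fun τ : ℝ => ψ (t, x + τ • h)) (fderiv ℝ ψ (t, x) (0, h)) 0 := by
    refine HasFDerivAt.comp_hasDerivAt (f := fun τ : ℝ => (t, x + τ • h)) 0 ?_ hline
    simpa using hψd ht hx
  have h2 := (hf (ψ (t, x + (0 : ℝ) • h))).hasFDerivAt.comp_hasDerivAt (0 : ℝ) h1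
  simp only [zero_smul, add_zero] at h2
  exact h2.deriv

end FlowProperties

section JetCalculus

/-- The restriction of a jet to `x` and the coordinates in `S`. -/
def jetRestrict (S : Finset (Fin 2 × ℕ)) (p : JetB) : ℝ × (↥S → ℝ) := (p.1, fun a => p.2 a.1)

/-- The restriction to `S` of the total derivative field `∂/∂x + Σ y^{k+1}_L ∂/∂y^k_L`. -/
def jetShift (S : Finset (Fin 2 × ℕ)) (p : JetB) : ℝ × (↥S → ℝ) :=
  (1, fun a => p.2 (a.1.1, a.1.2 + 1))

/-- A curve through `p` tangent to the total derivative field. -/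
def jetCurve (p : JetB) (τ : ℝ) : JetB := (p.1 + τ, fun q => p.2 q + τ * p.2 (q.1, q.2 + 1))

/-- The derivative of `F` along the curves `jetCurve`. -/
noncomputable def curveD (F : JetB → ℝ) (p : JetB) : ℝ := deriv (fun τ => F (jetCurve p τ)) 0

theorem jetCurve_zero (p : JetB) : jetCurve p 0 = p := by simp [jetCurve]

theorem hasDerivAt_jetCurve_fst (p : JetB) : HasDerivAt (fun τ => (jetCurve p τ).1) 1 0 :=
  (hasDerivAt_id (0 : ℝ)).const_add p.1

theorem hasDerivAt_jetCurve_snd (p : JetB) (q : Fin 2 × ℕ) :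
    HasDerivAt (fun τ => (jetCurve p τ).2 q) (p.2 (q.1, q.2 + 1)) 0 := by
  have h := ((hasDerivAt_id (0 : ℝ)).mul_const (p.2 (q.1, q.2 + 1))).const_add (p.2 q)
  rw [one_mul] at h
  exact h

theorem continuous_jetCurve (p : JetB) : Continuous (jetCurve p) := by
  unfold jetCurve
  fun_prop

theorem eventually_jetCurve_mem {W : Set JetB} (hW : IsOpen W) {p : JetB} (hp : p ∈ W) :
    ∀ᶠ τ in 𝓝 (0 : ℝ), jetCurve p τ ∈ W :=
  (continuous_jetCurve p).continuousAt.eventually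
    (hW.mem_nhds (by rwa [jetCurve_zero]))

theorem curveD_snd (q : Fin 2 × ℕ) (p : JetB) :
    curveD (fun p => p.2 q) p = p.2 (q.1, q.2 + 1) := (hasDerivAt_jetCurve_snd p q).deriv

theorem curveD_fst (p : JetB) : curveD (fun p => p.1) p = 1 := (hasDerivAt_jetCurve_fst p).deriv

theorem curveD_congr {W : Set JetB} (hW : IsOpen W) {F G : JetB → ℝ} (h : EqOn F G W)
    {p : JetB} (hp : p ∈ W) : curveD F p = curveD G p := by
  refine Filter.EventuallyEq.deriv_eq ?_
  filter_upwards [eventually_jetCurve_mem hW hp] with τ hτ using h hτ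

theorem hasDerivAt_jetRestrict {S : Finset (Fin 2 × ℕ)} {c : ℝ → JetB} {m r : ℝ}
    (h1 : HasDerivAt (fun τ => (c τ).1) m r)
    (h2 : ∀ q, HasDerivAt (fun τ => (c τ).2 q) (m * (c r).2 (q.1, q.2 + 1)) r) :
    HasDerivAt (fun τ => jetRestrict S (c τ)) (m • jetShift S (c r)) r := by
  have h : HasDerivAt (fun τ => jetRestrict S (c τ))
      (m, fun a : ↥S => m * (c r).2 (a.1.1, a.1.2 + 1)) r :=
    h1.prodMk (hasDerivAt_pi.2 fun a => h2 a.1)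
  refine h.congr_deriv (Prod.ext ?_ ?_)
  · simp [jetShift]
  · ext a
    simp [jetShift]

theorem hasDerivAt_jetRestrict_jetCurve (S : Finset (Fin 2 × ℕ)) (p : JetB) :
    HasDerivAt (fun τ => jetRestrict S (jetCurve p τ)) (jetShift S p) 0 := by
  have := hasDerivAt_jetRestrict (S := S) (hasDerivAt_jetCurve_fst p) (fun q => by
    simpa [jetCurve_zero] using hasDerivAt_jetCurve_snd p q)
  simpa [jetCurve_zero] using this

/-- The coordinates in `S` and their total derivatives. -/
def shiftClosure (S : Finset (Fin 2 × ℕ)) : Finset (Fin 2 × ℕ) :=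
  S ∪ S.image fun q => (q.1, q.2 + 1)

/-- The projection onto fewer coordinates. -/
def restrictCLM {S T : Finset (Fin 2 × ℕ)} (h : S ⊆ T) :
    ℝ × (↥T → ℝ) →L[ℝ] ℝ × (↥S → ℝ) :=
  (ContinuousLinearMap.fst ℝ ℝ _).prod (ContinuousLinearMap.pi fun a =>
    (ContinuousLinearMap.proj (⟨a.1, h a.2⟩ : ↥T)).comp (ContinuousLinearMap.snd ℝ ℝ _))

theorem subset_shiftClosure (S : Finset (Fin 2 × ℕ)) : S ⊆ shiftClosure S :=
  Finset.subset_union_left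

theorem shift_mem_shiftClosure {S : Finset (Fin 2 × ℕ)} (a : ↥S) :
    (a.1.1, a.1.2 + 1) ∈ shiftClosure S :=
  Finset.mem_union_right _ (Finset.mem_image_of_mem _ a.2)

/-- `jetShift S` as a function of the coordinates in `shiftClosure S`. -/
def shiftOfRestrict (S : Finset (Fin 2 × ℕ)) (z : ℝ × (↥(shiftClosure S) → ℝ)) :
    ℝ × (↥S → ℝ) :=
  (1, fun a => z.2 ⟨_, shift_mem_shiftClosure a⟩)

theorem contDiff_shiftOfRestrict (S : Finset (Fin 2 × ℕ)) :
    ContDiff ℝ ∞ (shiftOfRestrict S) :=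
  contDiff_const.prodMk (contDiff_pi.2 fun _ => (contDiff_apply ℝ ℝ _).comp contDiff_snd)

end JetCalculus

section AdmissibleT

variable {I : Set ℝ} {W : Set JetB}

theorem AdmissibleTOn.curveD_eq (hW : IsOpen W) {F : ℝ → JetB → ℝ} {S : Finset (Fin 2 × ℕ)}
    {U : Set (ℝ × ℝ × (↥S → ℝ))} {g : ℝ × ℝ × (↥S → ℝ) → ℝ} (hU : IsOpen U)
    (hg : ContDiffOn ℝ ∞ g U)
    (hFg : ∀ t ∈ I, ∀ p ∈ W, (t, jetRestrict S p) ∈ U ∧ F t p = g (t, jetRestrict S p))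
    {t : ℝ} (ht : t ∈ I) {p : JetB} (hp : p ∈ W) :
    curveD (F t) p = fderiv ℝ g (t, jetRestrict S p) (0, jetShift S p) := by
  have hd : HasFDerivAt g _ (t, jetRestrict S p) :=
    ((hg.contDiffAt (hU.mem_nhds (hFg t ht _ hp).1)).differentiableAt (by simp)).hasFDerivAt
  have hcomp := HasFDerivAt.comp_hasDerivAt (f := fun τ => (t, jetRestrict S (jetCurve p τ)))
    0 (by rwa [jetCurve_zero])
    ((hasDerivAt_const 0 t).prodMk (hasDerivAt_jetRestrict_jetCurve S p))
  refine (hcomp.congr_of_eventuallyEq ?_).deriv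
  filter_upwards [eventually_jetCurve_mem hW hp] with τ hτ using (hFg t ht _ hτ).2

/-- The derivative of a time-dependent admissible function along curves tangent to multiples of
the total derivative field. -/
theorem AdmissibleTOn.hasDerivAt_curve (hW : IsOpen W) {F : ℝ → JetB → ℝ}
    (hF : AdmissibleTOn I W F) {t : ℝ} (ht : t ∈ I) {c : ℝ → JetB} {m r : ℝ}
    (h1 : HasDerivAt (fun τ => (c τ).1) m r)
    (h2 : ∀ q, HasDerivAt (fun τ => (c τ).2 q) (m * (c r).2 (q.1, q.2 + 1)) r)
    (hc : c r ∈ W) :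
    HasDerivAt (fun τ => F t (c τ)) (m * curveD (F t) (c r)) r := by
  obtain ⟨S, U, g, hU, hg, hFg⟩ := hF
  have hcc : ContinuousAt c r :=
    h1.continuousAt.prodMk (continuousAt_pi.2 fun q => (h2 q).continuousAt)
  have hd : HasFDerivAt g (fderiv ℝ g (t, jetRestrict S (c r))) (t, jetRestrict S (c r)) :=
    ((hg.contDiffAt (hU.mem_nhds (hFg t ht _ hc).1)).differentiableAt (by simp)).hasFDerivAt
  have hcomp := HasFDerivAt.comp_hasDerivAt (f := fun τ => (t, jetRestrict S (c τ))) r hd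
    ((hasDerivAt_const r t).prodMk (hasDerivAt_jetRestrict (S := S) h1 h2))
  have hlin : ((0 : ℝ), m • jetShift S (c r)) = m • ((0 : ℝ), jetShift S (c r)) := by simp
  rw [hlin, map_smul, smul_eq_mul, ← AdmissibleTOn.curveD_eq hW hU hg hFg ht hc] at hcomp
  refine hcomp.congr_of_eventuallyEq ?_
  filter_upwards [hcc.eventually (hW.mem_nhds hc)] with τ hτ using (hFg t ht _ hτ).2

theorem AdmissibleTOn.hasDerivAt_jetCurve (hW : IsOpen W) {F : ℝ → JetB → ℝ}
    (hF : AdmissibleTOn I W F) {t : ℝ} (ht : t ∈ I) {p : JetB} (hp : p ∈ W) :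
    HasDerivAt (fun τ => F t (jetCurve p τ)) (curveD (F t) p) 0 := by
  have := hF.hasDerivAt_curve hW ht (hasDerivAt_jetCurve_fst p)
      (fun q => by simpa [jetCurve_zero] using hasDerivAt_jetCurve_snd p q)
      (by rwa [jetCurve_zero])
  simpa [jetCurve_zero] using this

theorem AdmissibleTOn.curveD (hW : IsOpen W) {F : ℝ → JetB → ℝ} (hF : AdmissibleTOn I W F) :
    AdmissibleTOn I W fun t => curveD (F t) := by
  obtain ⟨S, U, g, hU, hg, hFg⟩ := hF
  let π : ℝ × ℝ × (↥(shiftClosure S) → ℝ) → ℝ × ℝ × (↥S → ℝ) := fun z =>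
    (z.1, restrictCLM (subset_shiftClosure S) z.2)
  have hπ : ContDiff ℝ ∞ π :=
    contDiff_fst.prodMk ((restrictCLM (subset_shiftClosure S)).contDiff.comp contDiff_snd)
  refine ⟨shiftClosure S, π ⁻¹' U, fun z => fderiv ℝ g (π z) (0, shiftOfRestrict S z.2),
    hU.preimage hπ.continuous, ?_, fun t ht p hp =>
      ⟨(hFg t ht p hp).1, AdmissibleTOn.curveD_eq hW hU hg hFg ht hp⟩⟩
  exact ((hg.fderiv_of_isOpen hU (by simp)).comp hπ.contDiffOn fun _ h => h).clm_apply
    (contDiff_const.prodMk ((contDiff_shiftOfRestrict S).comp contDiff_snd)).contDiffOn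

theorem AdmissibleTOn.div {F G : ℝ → JetB → ℝ} (hF : AdmissibleTOn I W F)
    (hG : AdmissibleTOn I W G) (h0 : ∀ t ∈ I, ∀ p ∈ W, G t p ≠ 0) :
    AdmissibleTOn I W fun t p => F t p / G t p := by
  obtain ⟨S, U, g, hU, hg, hFg⟩ := hF
  obtain ⟨T, V, h, hV, hh, hGh⟩ := hG
  let π : ℝ × ℝ × (↥(S ∪ T) → ℝ) → ℝ × ℝ × (↥S → ℝ) := fun z =>
    (z.1, restrictCLM Finset.subset_union_left z.2)
  let ρ : ℝ × ℝ × (↥(S ∪ T) → ℝ) → ℝ × ℝ × (↥T → ℝ) := fun z =>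
    (z.1, restrictCLM Finset.subset_union_right z.2)
  have hπ : ContDiff ℝ ∞ π :=
    contDiff_fst.prodMk ((restrictCLM Finset.subset_union_left).contDiff.comp contDiff_snd)
  have hρ : ContDiff ℝ ∞ ρ :=
    contDiff_fst.prodMk ((restrictCLM Finset.subset_union_right).contDiff.comp contDiff_snd)
  refine ⟨S ∪ T, π ⁻¹' U ∩ ρ ⁻¹' (V ∩ h ⁻¹' {0}ᶜ), fun z => g (π z) / h (ρ z),
    (hU.preimage hπ.continuous).inter ((hh.continuousOn.isOpen_inter_preimage hV
      isOpen_compl_singleton).preimage hρ.continuous), ?_, fun t ht p hp => ?_⟩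
  · exact ((hg.comp hπ.contDiffOn fun _ h => h).mono inter_subset_left).div
      ((hh.comp hρ.contDiffOn fun _ h => h).mono fun z hz => hz.2.1) fun z hz => hz.2.2
  · obtain ⟨h1, h2⟩ := hFg t ht p hp
    obtain ⟨h3, h4⟩ := hGh t ht p hp
    refine ⟨⟨h1, h3, ?_⟩, congrArg₂ _ h2 h4⟩
    intro h5
    exact h0 t ht p hp (h4.trans h5)

/-- Time derivatives commute with total derivatives. -/
theorem AdmissibleTOn.hasDerivAt_curveD (hW : IsOpen W) {δ : ℝ} (hδ : 0 < δ)
    {F : ℝ → JetB → ℝ} (hF : AdmissibleTOn (Ioo (-δ) δ) W F) {A : JetB → ℝ}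
    (hA : ∀ p ∈ W, HasDerivAt (fun t => F t p) (A p) 0) {p : JetB} (hp : p ∈ W) :
    HasDerivAt (fun t => _root_.curveD (F t) p) (_root_.curveD A p) 0 := by
  obtain ⟨S, U, g, hU, hg, hFg⟩ := hF
  have h0 : (0 : ℝ) ∈ Ioo (-δ) δ := ⟨by linarith, hδ⟩
  have hI : Ioo (-δ) δ ∈ 𝓝 (0 : ℝ) := Ioo_mem_nhds h0.1 h0.2
  have hga : ∀ p ∈ W, ContDiffAt ℝ ∞ g (0, jetRestrict S p) := fun p hp =>
    hg.contDiffAt (hU.mem_nhds (hFg 0 h0 p hp).1)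
  have key := (hga p hp).hasDerivAt_fderiv_swap (v := ((0 : ℝ), jetShift S p))
    (u := ((1 : ℝ), 0)) (WithTop.coe_le_coe.2 le_top)
    ((hasDerivAt_id (0 : ℝ)).prodMk (hasDerivAt_const (0 : ℝ) (jetRestrict S p))) rfl
    ((hasDerivAt_const (0 : ℝ) (0 : ℝ)).prodMk (hasDerivAt_jetRestrict_jetCurve S p))
    (by simp [jetCurve_zero])
  have hu : _root_.curveD A p = deriv (fun τ =>
      fderiv ℝ g ((0 : ℝ), jetRestrict S (jetCurve p τ)) (1, 0)) 0 := by
    refine Filter.EventuallyEq.deriv_eq ?_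
    filter_upwards [eventually_jetCurve_mem hW hp] with τ hτ
    refine (hA _ hτ).unique (HasDerivAt.congr_of_eventuallyEq
      (HasFDerivAt.comp_hasDerivAt (f := fun s : ℝ => (s, jetRestrict S (jetCurve p τ))) 0
        ((hga _ hτ).differentiableAt (by simp)).hasFDerivAt
        ((hasDerivAt_id (0 : ℝ)).prodMk (hasDerivAt_const _ _))) ?_)
    filter_upwards [hI] with s hs using (hFg s hs _ hτ).2
  rw [hu]
  refine key.congr_of_eventuallyEq ?_
  filter_upwards [hI] with s hs using AdmissibleTOn.curveD_eq hW hU hg hFg hs hp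

end AdmissibleT

section Admissible

theorem Admissible.exists_superset {F : JetB → ℝ} (hF : Admissible F) :
    ∃ S : Finset (Fin 2 × ℕ), ∀ T, S ⊆ T → ∃ g : ℝ × (↥T → ℝ) → ℝ,
      ContDiff ℝ ∞ g ∧ ∀ p, F p = g (jetRestrict T p) := by
  obtain ⟨S, g, hg, hFg⟩ := hF
  exact ⟨S, fun T h => ⟨fun z => g (restrictCLM h z), hg.comp (restrictCLM h).contDiff, hFg⟩⟩

theorem Admissible.comp₂ {F G : JetB → ℝ} (hF : Admissible F) (hG : Admissible G)
    {h : ℝ × ℝ → ℝ} (hh : ContDiff ℝ ∞ h) : Admissible fun p => h (F p, G p) := by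
  obtain ⟨S, hS⟩ := hF.exists_superset
  obtain ⟨T, hT⟩ := hG.exists_superset
  obtain ⟨f, hf, hFf⟩ := hS (S ∪ T) Finset.subset_union_left
  obtain ⟨g, hg, hGg⟩ := hT (S ∪ T) Finset.subset_union_right
  exact ⟨S ∪ T, fun z => h (f z, g z), hh.comp (hf.prodMk hg), fun p =>
    congrArg h (Prod.ext (hFf p) (hGg p))⟩

theorem admissible_snd (q : Fin 2 × ℕ) : Admissible fun p => p.2 q :=
  ⟨{q}, fun z => z.2 ⟨q, Finset.mem_singleton_self q⟩,
    (contDiff_apply ℝ ℝ _).comp contDiff_snd, fun _ => rfl⟩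

theorem hasDerivAt_jetRestrict_fst (S : Finset (Fin 2 × ℕ)) (p : JetB) :
    HasDerivAt (fun s => jetRestrict S (s, p.2)) (1, 0) p.1 :=
  (hasDerivAt_id p.1).prodMk (hasDerivAt_const p.1 fun a : ↥S => p.2 a.1)

theorem hasDerivAt_update_apply {ι : Type*} [DecidableEq ι] (y : ι → ℝ) (q a : ι) :
    HasDerivAt (fun s => Function.update y q s a) ((Pi.single q 1 : ι → ℝ) a) (y q) := by
  rcases eq_or_ne a q with rfl | h
  · simpa using hasDerivAt_id' (y a)
  · simpa [h] using hasDerivAt_const (y q) (y a)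

theorem hasDerivAt_jetRestrict_snd (S : Finset (Fin 2 × ℕ)) (p : JetB) (q : Fin 2 × ℕ) :
    HasDerivAt (fun s => jetRestrict S (p.1, Function.update p.2 q s))
      (0, fun a => (Pi.single q 1 : Fin 2 × ℕ → ℝ) a.1) (p.2 q) :=
  (hasDerivAt_const _ _).prodMk (hasDerivAt_pi.2 fun a => hasDerivAt_update_apply p.2 q a.1)

theorem totD_eq_fderiv {F : JetB → ℝ} {S : Finset (Fin 2 × ℕ)} {g : ℝ × (↥S → ℝ) → ℝ}
    (hg : Differentiable ℝ g) (hFg : ∀ p, F p = g (jetRestrict S p)) (p : JetB) :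
    totD F p = fderiv ℝ g (jetRestrict S p) (jetShift S p) := by
  have hF : F = fun p => g (jetRestrict S p) := funext hFg
  have hX : pdX F p = fderiv ℝ g (jetRestrict S p) (1, 0) := by
    rw [hF]
    exact (HasFDerivAt.comp_hasDerivAt (f := fun s => jetRestrict S (s, p.2)) p.1
      (hg (jetRestrict S p)).hasFDerivAt (hasDerivAt_jetRestrict_fst S p)).deriv
  have hY : ∀ q, pdY q F p = fderiv ℝ g (jetRestrict S p)
      (0, fun a => (Pi.single q 1 : Fin 2 × ℕ → ℝ) a.1) := by
    intro q
    rw [hF]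
    refine (HasFDerivAt.comp_hasDerivAt
      (f := fun s => jetRestrict S (p.1, Function.update p.2 q s)) (p.2 q) ?_
      (hasDerivAt_jetRestrict_snd S p q)).deriv
    rw [Function.update_eq_self]
    exact (hg (jetRestrict S p)).hasFDerivAt
  have hsupp : (Function.support fun q : Fin 2 × ℕ => p.2 (q.1, q.2 + 1) * pdY q F p) ⊆ S := by
    intro q hq
    by_contra hqS
    refine hq ?_
    have : (fun a : ↥S => (Pi.single q 1 : Fin 2 × ℕ → ℝ) a.1) = 0 := by
      ext a
      have : a.1 ≠ q := fun h => hqS (h ▸ a.2)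
      simp [this]
    simp only [hY, this]
    exact mul_eq_zero_of_right _ (map_zero _)
  rw [totD, finsum_eq_sum_of_support_subset _ hsupp, hX]
  have hsum : jetShift S p = (1, 0) + ∑ q ∈ S, p.2 (q.1, q.2 + 1) •
      ((0 : ℝ), fun a : ↥S => (Pi.single q 1 : Fin 2 × ℕ → ℝ) a.1) := by
    refine Prod.ext ?_ ?_
    · simp [jetShift, Prod.fst_sum]
    · ext a
      simp only [jetShift, Prod.snd_add, Prod.snd_sum, Prod.smul_snd, zero_add,
        Finset.sum_apply, Pi.smul_apply, Pi.single_apply, smul_eq_mul, mul_ite, mul_one, mul_zero]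
      rw [Finset.sum_ite_eq S a.1 fun q => p.2 (q.1, q.2 + 1), if_pos a.2]
  rw [hsum, map_add, map_sum]
  simp only [map_smul, smul_eq_mul, hY]

theorem Admissible.totD_eq_curveD {F : JetB → ℝ} (hF : Admissible F) (p : JetB) :
    totD F p = curveD F p := by
  obtain ⟨S, g, hg, hFg⟩ := hF
  have hgd : Differentiable ℝ g := hg.differentiable (by simp)
  rw [totD_eq_fderiv hgd hFg]
  have hF' : F = fun p => g (jetRestrict S p) := funext hFg
  rw [curveD, hF']
  refine (HasFDerivAt.comp_hasDerivAt (f := fun τ => jetRestrict S (jetCurve p τ)) 0 ?_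
    (hasDerivAt_jetRestrict_jetCurve S p)).deriv.symm
  rw [jetCurve_zero]
  exact (hgd _).hasFDerivAt

theorem Admissible.totD {F : JetB → ℝ} (hF : Admissible F) : Admissible (totD F) := by
  obtain ⟨S, g, hg, hFg⟩ := hF
  refine ⟨shiftClosure S, fun z => fderiv ℝ g (restrictCLM (subset_shiftClosure S) z)
    (shiftOfRestrict S z), ?_, totD_eq_fderiv (hg.differentiable (by simp)) hFg⟩
  exact ((hg.fderiv_right (by simp)).comp
    (restrictCLM (subset_shiftClosure S)).contDiff).clm_apply (contDiff_shiftOfRestrict S)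

theorem Admissible.etaLB {ξ : JetB → ℝ} {η0 : Fin 2 → JetB → ℝ} (hξ : Admissible ξ)
    (hη : ∀ L, Admissible (η0 L)) (L : Fin 2) (k : ℕ) : Admissible (etaLB ξ η0 L k) := by
  induction k with
  | zero => exact hη L
  | succ k ih =>
    exact ih.totD.comp₂ ((admissible_snd (L, k + 1)).comp₂ hξ.totD contDiff_mul)
      (h := fun z => z.1 - z.2) (by fun_prop)

end Admissible

section FirstOrder

/-- The space of first-order jets `(x, (y^0_1, y^0_2), (y^1_1, y^1_2))`. -/
abbrev Jet1 := ℝ × (Fin 2 → ℝ) × (Fin 2 → ℝ)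

theorem continuous_proj1 : Continuous proj1 := by
  unfold proj1
  fun_prop

/-- The jet with the given first-order part and vanishing higher coordinates. -/
def jetOfJet1 (v : Jet1) : JetB :=
  (v.1, fun q => if q.2 = 0 then v.2.1 q.1 else if q.2 = 1 then v.2.2 q.1 else 0)

theorem continuous_jetOfJet1 : Continuous jetOfJet1 := by
  refine continuous_fst.prodMk (continuous_pi fun q => ?_)
  split_ifs <;> fun_prop

theorem proj1_jetOfJet1 (v : Jet1) : proj1 (jetOfJet1 v) = v := by
  simp [proj1, jetOfJet1]

theorem LowOrder.exists_jet1 {F : JetB → ℝ} (hF : LowOrder F) (hA : Admissible F) :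
    ∃ f : Jet1 → ℝ, ContDiff ℝ ∞ f ∧ F = fun p => f (proj1 p) := by
  obtain ⟨S, g, hg, hFg⟩ := hA
  refine ⟨fun v => g (jetRestrict S (jetOfJet1 v)), hg.comp ?_, funext fun p => ?_⟩
  · refine contDiff_fst.prodMk (contDiff_pi.2 fun a => ?_)
    change ContDiff ℝ ∞ fun v : Jet1 => (jetOfJet1 v).2 a.1
    simp only [jetOfJet1]
    split_ifs <;> fun_prop
  · refine (hF p (jetOfJet1 (proj1 p)) rfl fun L k hk => ?_).trans (hFg _)
    interval_cases k <;> simp [jetOfJet1, proj1]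

/-- A time-dependent function of first-order jets is admissible. -/
theorem admissibleTOn_of_jet1 {I : Set ℝ} {W : Set JetB} {V : Set (ℝ × Jet1)}
    {G : ℝ × Jet1 → ℝ} (hV : IsOpen V) (hG : ContDiffOn ℝ ∞ G V)
    (h : ∀ t ∈ I, ∀ p ∈ W, (t, proj1 p) ∈ V) : AdmissibleTOn I W fun t p => G (t, proj1 p) := by
  let S : Finset (Fin 2 × ℕ) := Finset.univ ×ˢ Finset.range 2
  have hS : ∀ (L : Fin 2) (k : ℕ), k < 2 → (L, k) ∈ S := by simp [S]
  let ρ : ℝ × ℝ × (↥S → ℝ) → ℝ × Jet1 := fun z =>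
    (z.1, z.2.1, fun L => z.2.2 ⟨(L, 0), hS L 0 (by norm_num)⟩,
      fun L => z.2.2 ⟨(L, 1), hS L 1 (by norm_num)⟩)
  have hρ : ContDiff ℝ ∞ ρ := by
    refine contDiff_fst.prodMk (contDiff_snd.fst.prodMk
      ((contDiff_pi.2 fun L => ?_).prodMk (contDiff_pi.2 fun L => ?_))) <;> fun_prop
  exact ⟨S, ρ ⁻¹' V, G ∘ ρ, hV.preimage hρ.continuous, hG.comp hρ.contDiffOn fun _ h => h,
    fun t ht p hp => ⟨h t ht p hp, rfl⟩⟩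

variable {f : Jet1 → ℝ}

theorem pdX_comp_proj1 (hf : Differentiable ℝ f) (p : JetB) :
    pdX (fun p => f (proj1 p)) p = fderiv ℝ f (proj1 p) (1, 0, 0) :=
  (HasFDerivAt.comp_hasDerivAt (f := fun s => proj1 (s, p.2)) p.1 (hf (proj1 p)).hasFDerivAt
    ((hasDerivAt_id p.1).prodMk (hasDerivAt_const p.1 (proj1 p).2))).deriv

theorem pdY_comp_proj1 (hf : Differentiable ℝ f) (p : JetB) (q : Fin 2 × ℕ) :
    pdY q (fun p => f (proj1 p)) p =
      fderiv ℝ f (proj1 p) (proj1 (0, Pi.single q 1)) := by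
  refine (HasFDerivAt.comp_hasDerivAt (f := fun s => proj1 (p.1, Function.update p.2 q s))
    (p.2 q) ?_ (f' := proj1 (0, Pi.single q 1)) ((hasDerivAt_const _ _).prodMk
      ((hasDerivAt_pi.2 fun L => hasDerivAt_update_apply p.2 q (L, 0)).prodMk
        (hasDerivAt_pi.2 fun L => hasDerivAt_update_apply p.2 q (L, 1))))).deriv
  rw [Function.update_eq_self]
  exact (hf (proj1 p)).hasFDerivAt

theorem proj1_single_zero (L : Fin 2) :
    proj1 (0, Pi.single (L, 0) 1) = (0, Pi.single L 1, 0) := by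
  ext K <;> simp [proj1, Pi.single_apply]

theorem proj1_single_one (L : Fin 2) :
    proj1 (0, Pi.single (L, 1) 1) = (0, 0, Pi.single L 1) := by
  ext K <;> simp [proj1, Pi.single_apply]

end FirstOrder

section CharacteristicMatrix

/-- The inclusion of the directions `∂/∂y^1_L`. -/
noncomputable def vertCLM : (Fin 2 → ℝ) →L[ℝ] Jet1 :=
  (ContinuousLinearMap.inr ℝ ℝ _).comp (ContinuousLinearMap.inr ℝ (Fin 2 → ℝ) (Fin 2 → ℝ))

theorem vertCLM_apply (h : Fin 2 → ℝ) : vertCLM h = (0, 0, h) := rfl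

/-- The coordinate `y^1_L` as a linear functional. -/
noncomputable def coordCLM (L : Fin 2) : Jet1 →L[ℝ] ℝ :=
  (ContinuousLinearMap.proj L).comp
    ((ContinuousLinearMap.snd ℝ _ _).comp (ContinuousLinearMap.snd ℝ _ _))

theorem coordCLM_apply (L : Fin 2) (v : Jet1) : coordCLM L v = v.2.2 L := rfl

/-- The first-order part `∂/∂x + Σ y^1_L ∂/∂y^0_L` of the total derivative. -/
def horizVec (v : Jet1) : Jet1 := (1, v.2.2, 0)

theorem contDiff_horizVec : ContDiff ℝ ∞ horizVec := by
  unfold horizVec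
  fun_prop

variable (a : Jet1 → ℝ) (b : Fin 2 → Jet1 → ℝ)

/-- The one-forms `dη^0_L − y^1_L dξ` on the first-order jet space. -/
noncomputable def contactForm (L : Fin 2) (v : Jet1) : Jet1 →L[ℝ] ℝ :=
  fderiv ℝ (b L) v - v.2.2 L • fderiv ℝ a v

theorem contactForm_apply (L : Fin 2) (v w : Jet1) :
    contactForm a b L v w = fderiv ℝ (b L) v w - v.2.2 L * fderiv ℝ a v w := rfl

/-- The rows of the matrix `(M^R_L)`. -/
noncomputable def charRow (R : Fin 2) (v : Jet1) : Fin 2 → ℝ := fun L =>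
  contactForm a b L v (vertCLM (Pi.single R 1))

/-- The first-order part of the Lie–Bäcklund field with `y^2 = 0`. -/
noncomputable def firstOrderField (v : Jet1) : Jet1 :=
  (a v, fun L => b L v, fun L => contactForm a b L v (horizVec v))

variable {a b} (ha : ContDiff ℝ ∞ a) (hb : ∀ L, ContDiff ℝ ∞ (b L))

include ha hb

theorem contDiff_contactForm (L : Fin 2) : ContDiff ℝ ∞ (contactForm a b L) := by
  refine ((hb L).fderiv_right (by simp)).sub (ContDiff.smul (f := fun v : Jet1 => v.2.2 L)
    (by fun_prop) (ha.fderiv_right (by simp)))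

theorem contDiff_charRow (R : Fin 2) : ContDiff ℝ ∞ (charRow a b R) :=
  contDiff_pi.2 fun L => (contDiff_contactForm ha hb L).clm_apply contDiff_const

theorem contDiff_contactForm_horizVec (L : Fin 2) :
    ContDiff ℝ ∞ fun v => contactForm a b L v (horizVec v) :=
  (contDiff_contactForm ha hb L).clm_apply contDiff_horizVec

theorem contDiff_firstOrderField : ContDiff ℝ ∞ (firstOrderField a b) :=
  ha.prodMk ((contDiff_pi.2 hb).prodMk (contDiff_pi.2 (contDiff_contactForm_horizVec ha hb)))

theorem Mcomp_comp_proj1 (R L : Fin 2) :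
    Mcomp (fun p => a (proj1 p)) (fun L p => b L (proj1 p)) R L =
      fun p => charRow a b R (proj1 p) L := by
  ext p
  simp only [Mcomp, pdY_comp_proj1 (ha.differentiable (by simp)),
    pdY_comp_proj1 ((hb L).differentiable (by simp)), proj1_single_one]
  rfl

theorem Ocomp_comp_proj1 (L : Fin 2) :
    Ocomp (fun p => a (proj1 p)) (fun L p => b L (proj1 p)) L =
      fun p => contactForm a b L (proj1 p) (1, 0, 0) := by
  ext p
  simp only [Ocomp, pdX_comp_proj1 (ha.differentiable (by simp)),
    pdX_comp_proj1 ((hb L).differentiable (by simp))]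
  rfl

theorem Ncomp_comp_proj1 (Q L : Fin 2) :
    Ncomp (fun p => a (proj1 p)) (fun L p => b L (proj1 p)) Q L =
      fun p => contactForm a b L (proj1 p) (0, Pi.single Q 1, 0) := by
  ext p
  simp only [Ncomp, pdY_comp_proj1 (ha.differentiable (by simp)),
    pdY_comp_proj1 ((hb L).differentiable (by simp)), proj1_single_zero]
  rfl

omit ha hb in
theorem map_jet1 {F : Type*} [AddCommGroup F] [Module ℝ F] [TopologicalSpace F]
    (φ : Jet1 →L[ℝ] F) (v : Jet1) :
    φ v = v.1 • φ (1, 0, 0) + ∑ K, v.2.1 K • φ (0, Pi.single K 1, 0) +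
      ∑ K, v.2.2 K • φ (0, 0, Pi.single K 1) := by
  simp only [← map_smul, ← map_sum, ← map_add]
  congr 1
  refine Prod.ext ?_ (Prod.ext (funext fun K => ?_) (funext fun K => ?_))
  · simp
  · fin_cases K <;> simp
  · fin_cases K <;> simp

omit ha hb in
theorem contactForm_horizVec (L : Fin 2) (v : Jet1) :
    contactForm a b L v (horizVec v) = contactForm a b L v (1, 0, 0) +
      ∑ Q, v.2.2 Q * contactForm a b L v (0, Pi.single Q 1, 0) := by
  rw [map_jet1 (contactForm a b L v) (horizVec v)]
  simp [horizVec]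

theorem fderiv_contactForm_horizVec (L : Fin 2) (v w : Jet1) :
    fderiv ℝ (fun v => contactForm a b L v (horizVec v)) v w =
      fderiv ℝ (fun v => contactForm a b L v (1, 0, 0)) v w +
      ∑ Q, (w.2.2 Q * contactForm a b L v (0, Pi.single Q 1, 0) +
        v.2.2 Q * fderiv ℝ (fun v => contactForm a b L v (0, Pi.single Q 1, 0)) v w) := by
  have hd : ∀ w, HasFDerivAt (fun v => contactForm a b L v w)
      (fderiv ℝ (fun v => contactForm a b L v w) v) v := fun w =>
    (((contDiff_contactForm ha hb L).clm_apply contDiff_const).differentiable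
      (by simp) v).hasFDerivAt
  have hy : ∀ Q, HasFDerivAt (fun v : Jet1 => v.2.2 Q) (coordCLM Q) v := fun Q =>
    (coordCLM Q).hasFDerivAt
  rw [funext fun v => contactForm_horizVec (a := a) (b := b) L v,
    ((hd _).fun_add (HasFDerivAt.fun_sum fun Q _ => (hy Q).fun_mul (hd _))).fderiv]
  simp [coordCLM_apply, mul_comm, add_comm]

theorem Qcomp_comp_proj1 (R L : Fin 2) (p : JetB) :
    Qcomp (fun p => a (proj1 p)) (fun L p => b L (proj1 p)) R L p =
      fderiv ℝ (fun v => charRow a b R v L) (proj1 p) (firstOrderField a b (proj1 p)) -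
      fderiv ℝ (fun v => contactForm a b L v (horizVec v)) (proj1 p)
        (vertCLM (charRow a b R (proj1 p))) := by
  have hcd : ∀ w L, Differentiable ℝ fun v => contactForm a b L v w := fun w L =>
    ((contDiff_contactForm ha hb L).clm_apply contDiff_const).differentiable (by simp)
  have hmd : Differentiable ℝ fun v => charRow a b R v L := hcd _ L
  rw [fderiv_contactForm_horizVec ha hb, map_jet1 _ (firstOrderField a b (proj1 p))]
  simp only [Qcomp, Mcomp_comp_proj1 ha hb, Ocomp_comp_proj1 ha hb, Ncomp_comp_proj1 ha hb,
    pdX_comp_proj1 hmd, pdY_comp_proj1 hmd, pdY_comp_proj1 (hcd _ _), proj1_single_zero,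
    proj1_single_one]
  rw [map_jet1 _ (vertCLM (charRow a b R (proj1 p)))]
  simp only [map_jet1 _ (vertCLM (charRow a b R (proj1 p)))]
  simp only [firstOrderField, contactForm_horizVec, vertCLM_apply, smul_eq_mul,
    Fin.sum_univ_two, Pi.zero_apply, proj1]
  ring

end CharacteristicMatrix

section Invariance

theorem fderiv_vertCLM {a : Jet1 → ℝ} (v : Jet1) (h : Fin 2 → ℝ) :
    fderiv ℝ a v (vertCLM h) = ∑ K, h K * fderiv ℝ a v (vertCLM (Pi.single K 1)) := by
  rw [map_jet1 _ (vertCLM h)]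
  simp [vertCLM_apply]

/-- The kernel of a nonzero functional on the plane is spanned by any of its nonzero elements. -/
theorem exists_smul_eq_of_apply_eq_zero {φ : (Fin 2 → ℝ) →L[ℝ] ℝ} (hφ : φ ≠ 0) {w h : Fin 2 → ℝ}
    (hw : w ≠ 0) (hφw : φ w = 0) (hφh : φ h = 0) : ∃ c : ℝ, h = c • w := by
  have hrep : ∀ u, φ u = u 0 * φ (Pi.single 0 1) + u 1 * φ (Pi.single 1 1) := by
    intro u
    rw [← smul_eq_mul, ← smul_eq_mul, ← map_smul, ← map_smul, ← map_add]
    congr 1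
    ext K
    fin_cases K <;> simp
  set r := φ (Pi.single 0 1)
  set s := φ (Pi.single 1 1)
  rw [hrep] at hφw hφh
  have hdet : h 0 * w 1 = h 1 * w 0 := by
    by_cases hr : r = 0
    · have hs : s ≠ 0 := by
        intro hs
        refine hφ (ContinuousLinearMap.ext fun u => ?_)
        simp [hrep u, hr, hs]
      simp only [hr, mul_zero, zero_add, mul_eq_zero, hs, or_false] at hφw hφh
      simp [hφw, hφh]
    · have : r * (h 0 * w 1 - h 1 * w 0) = 0 := by linear_combination w 1 * hφh - h 1 * hφw
      linarith [(mul_eq_zero.1 this).resolve_left hr]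
  by_cases h0 : w 0 = 0
  · have h1 : w 1 ≠ 0 := by
      intro h1
      refine hw (funext fun K => ?_)
      fin_cases K <;> simp [h0, h1]
    refine ⟨h 1 / w 1, funext fun K => ?_⟩
    fin_cases K
    · simp only [h0, mul_zero, mul_eq_zero, h1, or_false] at hdet
      simp [h0, hdet]
    · simp [h1]
  · refine ⟨h 0 / w 0, funext fun K => ?_⟩
    fin_cases K
    · simp [h0]
    · simp only [Fin.mk_one, Pi.smul_apply, smul_eq_mul]
      field_simp
      linarith

variable {a : Jet1 → ℝ} {b : Fin 2 → Jet1 → ℝ} (ha : ContDiff ℝ ∞ a)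
  (hb : ∀ L, ContDiff ℝ ∞ (b L))

include ha hb

/-- If the rows of `(M^R_L)` and `(Q^R_L)` annihilate `ξ`, `η^0_L` and `G`, the rows of `(M^R_L)`
annihilate the derivative of `G` along the Lie–Bäcklund field. -/
theorem fderiv_fderiv_firstOrderField {G : Jet1 → ℝ} (hG : ContDiff ℝ ∞ G) {R : Fin 2}
    (hia : ∀ v, fderiv ℝ a v (vertCLM (charRow a b R v)) = 0)
    (hib : ∀ L v, fderiv ℝ (b L) v (vertCLM (charRow a b R v)) = 0)
    (hiG : ∀ v, fderiv ℝ G v (vertCLM (charRow a b R v)) = 0)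
    (hiiG : ∀ v, fderiv ℝ G v (vertCLM fun L =>
      fderiv ℝ (fun v => charRow a b R v L) v (firstOrderField a b v) -
      fderiv ℝ (fun v => contactForm a b L v (horizVec v)) v (vertCLM (charRow a b R v))) = 0)
    (v : Jet1) :
    fderiv ℝ (fun v => fderiv ℝ G v (firstOrderField a b v)) v
      (vertCLM (charRow a b R v)) = 0 := by
  have h1 : HasFDerivAt (fderiv ℝ G) (fderiv ℝ (fderiv ℝ G) v) v :=
    ((hG.fderiv_right (m := ∞) (by simp)).differentiable (by simp) v).hasFDerivAt
  have hsymm : IsSymmSndFDerivAt ℝ G v :=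
    hG.contDiffAt.isSymmSndFDerivAt (by
      rw [minSmoothness_of_isRCLikeNormedField]
      exact WithTop.coe_le_coe.2 le_top)
  have hrow : HasFDerivAt (charRow a b R) (fderiv ℝ (charRow a b R) v) v :=
    ((contDiff_charRow ha hb R).differentiable (by simp) v).hasFDerivAt
  have hda : HasFDerivAt a (fderiv ℝ a v) v := (ha.differentiable (by simp) v).hasFDerivAt
  have hdb : HasFDerivAt (fun v L => b L v) (ContinuousLinearMap.pi fun L => fderiv ℝ (b L) v) v :=
    hasFDerivAt_pi.2 fun L => ((hb L).differentiable (by simp) v).hasFDerivAt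
  have hdω : HasFDerivAt (fun v L => contactForm a b L v (horizVec v))
      (ContinuousLinearMap.pi fun L =>
        fderiv ℝ (fun v => contactForm a b L v (horizVec v)) v) v :=
    hasFDerivAt_pi.2 fun L =>
      ((contDiff_contactForm_horizVec ha hb L).differentiable (by simp) v).hasFDerivAt
  have hB := h1.clm_apply (vertCLM.hasFDerivAt.comp v hrow)
  have hZ := h1.clm_apply (hda.prodMk (hdb.prodMk hdω))
  have hB0 : (fun v => fderiv ℝ G v (vertCLM (charRow a b R v))) = fun _ => 0 := funext hiG
  have e1 := hB.unique (by
    change HasFDerivAt (fun v => fderiv ℝ G v (vertCLM (charRow a b R v))) 0 v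
    rw [hB0]
    exact hasFDerivAt_const _ _)
  have e2 := DFunLike.congr_fun e1 (firstOrderField a b v)
  have e3 := DFunLike.congr_fun hZ.fderiv (vertCLM (charRow a b R v))
  refine (show _ = _ from e3).trans ?_
  simp only [add_apply, ContinuousLinearMap.comp_apply,
    ContinuousLinearMap.flip_apply, zero_apply,
    ContinuousLinearMap.prod_apply] at e2 ⊢
  have e4 := hiiG v
  have e5 : ∀ L, fderiv ℝ (fun v => charRow a b R v L) v = 
      (ContinuousLinearMap.proj L).comp (fderiv ℝ (charRow a b R) v) := fun L =>
    (hasFDerivAt_pi'.1 hrow L).fderiv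
  have e6 : (vertCLM fun L =>
      fderiv ℝ (fun v => charRow a b R v L) v (firstOrderField a b v) -
      fderiv ℝ (fun v => contactForm a b L v (horizVec v)) v (vertCLM (charRow a b R v))) =
      vertCLM (fderiv ℝ (charRow a b R) v (firstOrderField a b v)) - 
      vertCLM (fun L => fderiv ℝ (fun v => contactForm a b L v (horizVec v)) v
        (vertCLM (charRow a b R v))) := by
    rw [← map_sub]
    simp only [e5]
    rfl
  have e7 : ((fderiv ℝ a v (vertCLM (charRow a b R v)),
      (ContinuousLinearMap.pi fun L => fderiv ℝ (b L) v) (vertCLM (charRow a b R v)),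
      (ContinuousLinearMap.pi fun L => fderiv ℝ (fun v => contactForm a b L v (horizVec v)) v)
        (vertCLM (charRow a b R v))) : Jet1) = 
      vertCLM (fun L => fderiv ℝ (fun v => contactForm a b L v (horizVec v)) v
        (vertCLM (charRow a b R v))) := by
    refine Prod.ext (hia v) (Prod.ext (funext fun L => hib L v) rfl)
  rw [e6, map_sub, sub_eq_zero] at e4
  have e8 := hsymm (vertCLM (charRow a b R v)) (firstOrderField a b v)
  rw [e7, ← e4]
  change _ + fderiv ℝ (fderiv ℝ G) v (vertCLM (charRow a b R v)) (firstOrderField a b v) = 0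
  rw [e8]
  exact e2

/-- Under the identities for the rows of `(M^R_L)` and `(Q^R_L)`, one of `ξ`, `η^0_L` is a
function `f` on whose vertical level directions all of `ξ`, `η^0_L` and the derivative of `f` along
the Lie–Bäcklund field are constant. -/
theorem exists_vertical_generator {P : Jet1} (hm : ∃ Q, charRow a b Q P ≠ 0)
    (hi : ∀ G, (G = a ∨ ∃ L, G = b L) → ∀ R v, fderiv ℝ G v (vertCLM (charRow a b R v)) = 0)
    (hii : ∀ G, (G = a ∨ ∃ L, G = b L) → ∀ R v, fderiv ℝ G v (vertCLM fun L =>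
      fderiv ℝ (fun v => charRow a b R v L) v (firstOrderField a b v) -
      fderiv ℝ (fun v => contactForm a b L v (horizVec v)) v (vertCLM (charRow a b R v))) = 0) :
    ∃ f : Jet1 → ℝ, ContDiff ℝ ∞ f ∧ (∀ R v, fderiv ℝ f v (vertCLM (charRow a b R v)) = 0) ∧
      (∃ R, fderiv ℝ f P (vertCLM (Pi.single R 1)) ≠ 0) ∧
      ∀ᶠ v in 𝓝 P, ∀ h, fderiv ℝ f v (vertCLM h) = 0 → fderiv ℝ a v (vertCLM h) = 0 ∧
        (∀ L, fderiv ℝ (b L) v (vertCLM h) = 0) ∧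
        fderiv ℝ (fun v => fderiv ℝ f v (firstOrderField a b v)) v (vertCLM h) = 0 := by
  obtain ⟨Q, hQ⟩ := hm
  have hsm : ∀ G, (G = a ∨ ∃ L, G = b L) → ContDiff ℝ ∞ G := by
    rintro G (rfl | ⟨L, rfl⟩)
    exacts [ha, hb L]
  obtain ⟨f, hf, R, hR⟩ : ∃ f, (f = a ∨ ∃ L, f = b L) ∧
      ∃ R, fderiv ℝ f P (vertCLM (Pi.single R 1)) ≠ 0 := by
    by_contra! h
    refine hQ (funext fun L => ?_)
    simp [charRow, contactForm_apply, h a (Or.inl rfl) Q, h (b L) (Or.inr ⟨L, rfl⟩) Q]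
  have hfs := hsm f hf
  refine ⟨f, hfs, hi f hf, ⟨R, hR⟩, ?_⟩
  have hc1 : ContinuousAt (charRow a b Q) P := (contDiff_charRow ha hb Q).continuous.continuousAt
  have hc2 : ContinuousAt (fun v => fderiv ℝ f v (vertCLM (Pi.single R 1))) P :=
    ((hfs.continuous_fderiv (by simp)).clm_apply continuous_const).continuousAt
  filter_upwards [hc1.eventually_ne hQ, hc2.eventually_ne hR] with v hv1 hv2 h hh
  obtain ⟨c, rfl⟩ := exists_smul_eq_of_apply_eq_zero (φ := (fderiv ℝ f v).comp vertCLM)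
    (fun h0 => hv2 (DFunLike.congr_fun h0 (Pi.single R 1))) hv1 (hi f hf Q v) hh
  simp only [map_smul]
  refine ⟨by rw [hi a (Or.inl rfl) Q v, smul_zero], fun L => by
    rw [hi (b L) (Or.inr ⟨L, rfl⟩) Q v, smul_zero], ?_⟩
  rw [fderiv_fderiv_firstOrderField ha hb hfs (hi a (Or.inl rfl) Q)
    (fun L => hi (b L) (Or.inr ⟨L, rfl⟩) Q) (hi f hf Q) (hii f hf Q), smul_zero]

end Invariance

section Descent

/-- The leaf space of vertical level directions, with coordinates `(x, (y^0_1, y^0_2), w)`. -/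
abbrev Leaf := ℝ × (Fin 2 → ℝ) × ℝ

/-- The projection onto the leaf space given by `f`. -/
def leafMap (f : Jet1 → ℝ) (v : Jet1) : Leaf := (v.1, v.2.1, f v)

/-- The map replacing the coordinate `y^1_R` by `f`. -/
noncomputable def replaceCoord (f : Jet1 → ℝ) (R : Fin 2) (v : Jet1) : Jet1 :=
  (v.1, v.2.1, fun K => if K = R then f v else v.2.2 K)

/-- The derivative of `replaceCoord`. -/
noncomputable def replaceCoordDeriv (φ : Jet1 →L[ℝ] ℝ) (R : Fin 2) : Jet1 →L[ℝ] Jet1 :=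
  (ContinuousLinearMap.fst ℝ _ _).prod (((ContinuousLinearMap.fst ℝ _ _).comp
    (ContinuousLinearMap.snd ℝ _ _)).prod (ContinuousLinearMap.pi fun K =>
      if K = R then φ else coordCLM K))

theorem replaceCoordDeriv_apply (φ : Jet1 →L[ℝ] ℝ) (R : Fin 2) (w : Jet1) :
    replaceCoordDeriv φ R w = (w.1, w.2.1, fun K => if K = R then φ w else w.2.2 K) := by
  refine Prod.ext rfl (Prod.ext rfl (funext fun K => ?_))
  change (if K = R then φ else _) w = if K = R then φ w else w.2.2 K
  split_ifs <;> rfl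

theorem hasFDerivAt_replaceCoord {f : Jet1 → ℝ} (hf : Differentiable ℝ f) (R : Fin 2)
    (v : Jet1) : HasFDerivAt (replaceCoord f R) (replaceCoordDeriv (fderiv ℝ f v) R) v := by
  refine hasFDerivAt_fst.prodMk (hasFDerivAt_snd.fst.prodMk (hasFDerivAt_pi.2 fun K => ?_))
  split_ifs
  · exact (hf v).hasFDerivAt
  · exact (coordCLM K).hasFDerivAt

theorem contDiff_replaceCoord {f : Jet1 → ℝ} (hf : ContDiff ℝ ∞ f) (R : Fin 2) :
    ContDiff ℝ ∞ (replaceCoord f R) := by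
  refine contDiff_fst.prodMk (contDiff_snd.fst.prodMk (contDiff_pi.2 fun K => ?_))
  split_ifs <;> fun_prop

theorem exists_equiv_replaceCoordDeriv {φ : Jet1 →L[ℝ] ℝ} {R : Fin 2}
    (hR : φ (vertCLM (Pi.single R 1)) ≠ 0) :
    ∃ A : Jet1 ≃L[ℝ] Jet1, (A : Jet1 →L[ℝ] Jet1) = replaceCoordDeriv φ R := by
  have hinj : Function.Injective (replaceCoordDeriv φ R : Jet1 →ₗ[ℝ] Jet1) := by
    refine (injective_iff_map_eq_zero _).2 fun w hw => ?_
    have hw' := (replaceCoordDeriv_apply φ R w).symm.trans hw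
    have h1 : w.1 = 0 := congrArg Prod.fst hw'
    have h2 : w.2.1 = 0 := congrArg (fun z : Jet1 => z.2.1) hw'
    have h3 : ∀ K, (if K = R then φ w else w.2.2 K) = 0 := fun K =>
      congrFun (congrArg (fun z : Jet1 => z.2.2) hw') K
    have hφ : φ w = 0 := by simpa using h3 R
    have hw3 : w = w.2.2 R • vertCLM (Pi.single R 1) := by
      refine Prod.ext (by simpa [vertCLM_apply] using h1)
        (Prod.ext (by simpa [vertCLM_apply] using h2) (funext fun K => ?_))
      by_cases hK : K = R
      · simp [vertCLM_apply, hK]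
      · simpa [vertCLM_apply, hK] using h3 K
    rw [hw3, map_smul, smul_eq_mul] at hφ
    rw [hw3, (mul_eq_zero.1 hφ).resolve_right hR, zero_smul]
  exact ⟨(LinearEquiv.ofInjectiveEndo _ hinj).toContinuousLinearEquiv,
    ContinuousLinearMap.ext fun _ => rfl⟩

/-- A function which is constant along a direction at all points of a segment in that direction
takes the same values at its endpoints. -/
theorem eq_of_fderiv_eq_zero_on_segment {E : Type*} [NormedAddCommGroup E] [NormedSpace ℝ E]
    {F : E → ℝ} {s : Set E} (hs : Convex ℝ s) (hF : ∀ z ∈ s, DifferentiableAt ℝ F z)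
    {z w : E} (hz : z ∈ s) (hw : w ∈ s) (h : ∀ u ∈ s, fderiv ℝ F u (w - z) = 0) : F w = F z := by
  have hmem : ∀ τ ∈ Icc (0 : ℝ) 1, z + τ • (w - z) ∈ s := fun τ hτ =>
    hs.add_smul_sub_mem hz hw hτ
  have hd : ∀ τ ∈ Icc (0 : ℝ) 1, HasDerivAt (fun τ : ℝ => F (z + τ • (w - z))) 0 τ := by
    intro τ hτ
    have h1 : HasDerivAt (fun τ : ℝ => z + τ • (w - z)) (w - z) τ := by
      simpa using ((hasDerivAt_id τ).smul_const (w - z)).const_add z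
    have h2 := (hF _ (hmem τ hτ)).hasFDerivAt.comp_hasDerivAt τ h1
    rwa [h _ (hmem τ hτ)] at h2
  have := constant_of_has_deriv_right_zero (fun τ hτ => (hd τ hτ).continuousAt.continuousWithinAt)
    (fun τ hτ => (hd τ (Ico_subset_Icc_self hτ)).hasDerivWithinAt) 1 (by simp)
  simpa using this

/-- A function constant along the vertical level directions of `f` factors, near a point, through
the leaf space. -/
theorem exists_descent {f G : Jet1 → ℝ} (hf : ContDiff ℝ ∞ f) (hG : ContDiff ℝ ∞ G) {P : Jet1}
    {R : Fin 2} (hR : fderiv ℝ f P (vertCLM (Pi.single R 1)) ≠ 0)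
    (h : ∀ᶠ v in 𝓝 P, ∀ h, fderiv ℝ f v (vertCLM h) = 0 → fderiv ℝ G v (vertCLM h) = 0) :
    ∃ H : Leaf → ℝ, ContDiff ℝ ∞ H ∧ HasCompactSupport H ∧
      ∀ᶠ v in 𝓝 P, G v = H (leafMap f v) := by
  have hfd : Differentiable ℝ f := hf.differentiable (by simp)
  obtain ⟨A, hA⟩ := exists_equiv_replaceCoordDeriv hR
  obtain ⟨e, he, hPe, hes⟩ := (contDiff_replaceCoord hf R).exists_openPartialHomeomorph
    (hA ▸ hasFDerivAt_replaceCoord hfd R P)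
  have heP : e.symm (replaceCoord f R P) = P := by rw [← he]; exact e.left_inv hPe
  have htarget : replaceCoord f R P ∈ e.target := by rw [← he]; exact e.map_source hPe
  have hsymm : ∀ z ∈ e.target, ContDiffAt ℝ ∞ e.symm z := fun z hz =>
    hes.contDiffAt (e.open_target.mem_nhds hz)
  have hgood : ∀ᶠ z in 𝓝 (replaceCoord f R P), z ∈ e.target ∧ ∀ h,
      fderiv ℝ f (e.symm z) (vertCLM h) = 0 → fderiv ℝ G (e.symm z) (vertCLM h) = 0 := by
    refine Filter.Eventually.and (e.open_target.mem_nhds htarget) ?_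
    exact (hsymm _ htarget).continuousAt.eventually (by rwa [heP])
  obtain ⟨r, hr, hball⟩ := Metric.eventually_nhds_iff_ball.1 hgood
  set B := Metric.ball (replaceCoord f R P) r
  have hFs : ∀ z ∈ B, ContDiffAt ℝ ∞ (fun z => G (e.symm z)) z := fun z hz =>
    hG.contDiffAt.comp z (hsymm z (hball z hz).1)
  have hconst : ∀ z ∈ B, ∀ k : Fin 2 → ℝ, k R = 0 →
      fderiv ℝ (fun z => G (e.symm z)) z (vertCLM k) = 0 := by
    intro z hz k hk
    obtain ⟨hzt, hz2⟩ := hball z hz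
    have hd : HasFDerivAt e.symm (fderiv ℝ e.symm z) z :=
      ((hsymm z hzt).differentiableAt (by simp)).hasFDerivAt
    have hid : (replaceCoordDeriv (fderiv ℝ f (e.symm z)) R).comp (fderiv ℝ e.symm z) =
        ContinuousLinearMap.id ℝ Jet1 := by
      refine ((hasFDerivAt_replaceCoord hfd R (e.symm z)).comp z hd).unique
        ((hasFDerivAt_id z).congr_of_eventuallyEq ?_)
      filter_upwards [e.open_target.mem_nhds hzt] with u hu
      rw [← he]
      exact e.right_inv hu
    have hw := (replaceCoordDeriv_apply (fderiv ℝ f (e.symm z)) R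
      (fderiv ℝ e.symm z (vertCLM k))).symm.trans (DFunLike.congr_fun hid (vertCLM k))
    set w := fderiv ℝ e.symm z (vertCLM k)
    have h1 : w.1 = 0 := congrArg Prod.fst hw
    have h2 : w.2.1 = 0 := congrArg (fun z : Jet1 => z.2.1) hw
    have h3 : fderiv ℝ f (e.symm z) w = 0 := by
      have := congrFun (congrArg (fun z : Jet1 => z.2.2) hw) R
      simpa [hk, vertCLM_apply] using this
    have hwv : w = vertCLM w.2.2 := Prod.ext h1 (Prod.ext h2 rfl)
    have hcomp : fderiv ℝ (fun z => G (e.symm z)) z = _ :=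
      ((hG.differentiable (by simp) (e.symm z)).hasFDerivAt.comp z hd).fderiv
    rw [hcomp]
    change fderiv ℝ G (e.symm z) w = 0
    rw [hwv] at h3 ⊢
    exact hz2 _ h3
  let j : Leaf → Jet1 := fun c => (c.1, c.2.1, fun K => if K = R then c.2.2 else P.2.2 K)
  have hj : ContDiff ℝ ∞ j := by
    refine contDiff_fst.prodMk (contDiff_snd.fst.prodMk (contDiff_pi.2 fun K => ?_))
    split_ifs <;> fun_prop
  have hjP : j (leafMap f P) = replaceCoord f R P := rfl
  obtain ⟨ρ, hρ, hρB⟩ := Metric.mem_nhds_iff.1 (hj.continuous.continuousAt.preimage_mem_nhds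
    (Metric.ball_mem_nhds (j (leafMap f P)) hr))
  let β : ContDiffBump (leafMap f P) := ⟨ρ / 4, ρ / 2, by linarith, by linarith⟩
  have hcomp : HasCompactSupport fun c => β c * G (e.symm (j c)) := β.hasCompactSupport.mul_right
  refine ⟨fun c => β c * G (e.symm (j c)), contMDiff_iff_contDiff.1 (contMDiff_of_tsupport
    fun c hc => contMDiffAt_iff_contDiffAt.2 ?_), hcomp, ?_⟩
  · have hc' : c ∈ Metric.closedBall (leafMap f P) (ρ / 2) := by
      rw [← show β.rOut = ρ / 2 from rfl, ← β.tsupport_eq]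
      exact tsupport_mul_subset_left hc
    have hcB : j c ∈ B := hρB (Metric.closedBall_subset_ball (by linarith) hc')
    exact β.contDiff.contDiffAt.mul ((hFs _ hcB).comp c hj.contDiffAt)
  · have hl : ContinuousAt (leafMap f) P := by
      have := hf.continuous
      unfold leafMap
      fun_prop
    filter_upwards [hl.eventually β.eventuallyEq_one, e.open_source.mem_nhds hPe,
      (contDiff_replaceCoord hf R).continuous.continuousAt.preimage_mem_nhds
        (Metric.ball_mem_nhds _ hr), hl.preimage_mem_nhds (Metric.ball_mem_nhds _ hρ)]
      with v hv1 hv2 hv3 hv4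
    have hz : j (leafMap f v) ∈ B := hρB hv4
    have hdiff : j (leafMap f v) - replaceCoord f R v =
        vertCLM fun K => if K = R then 0 else P.2.2 K - v.2.2 K := by
      refine Prod.ext (sub_self _) (Prod.ext (sub_self _) (funext fun K => ?_))
      change (if K = R then f v else P.2.2 K) - (if K = R then f v else v.2.2 K) =
        if K = R then 0 else P.2.2 K - v.2.2 K
      split_ifs <;> simp
    have := eq_of_fderiv_eq_zero_on_segment (convex_ball _ _)
      (fun z hz => (hFs z hz).differentiableAt (by simp)) hv3 hz fun u hu => by
        rw [hdiff]
        exact hconst u hu _ (by simp)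
    rw [show β (leafMap f v) = 1 from hv1, one_mul, this, ← he, e.left_inv hv2]

end Descent

section Prolongation

/-- The prolongation to all jet coordinates of a transformation of `(x, y^0_1, y^0_2)`. -/
noncomputable def prolong (X : ℝ → JetB → ℝ) (Y : Fin 2 → ℝ → JetB → ℝ) (L : Fin 2) :
    ℕ → ℝ → JetB → ℝ
  | 0 => Y L
  | k + 1 => fun t p => curveD (prolong X Y L k t) p / curveD (X t) p

/-- The map of the jet space with base components `X t`, `Y L t`. -/
noncomputable def prolongMap (X : ℝ → JetB → ℝ) (Y : Fin 2 → ℝ → JetB → ℝ) (t : ℝ) (p : JetB) :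
    JetB :=
  (X t p, fun q => prolong X Y q.1 q.2 t p)

variable {X : ℝ → JetB → ℝ} {Y : Fin 2 → ℝ → JetB → ℝ} {W : Set JetB}

theorem admissibleTOn_prolong {I : Set ℝ} (hW : IsOpen W) (hX : AdmissibleTOn I W X)
    (hY : ∀ L, AdmissibleTOn I W (Y L)) (hne : ∀ t ∈ I, ∀ p ∈ W, curveD (X t) p ≠ 0)
    (L : Fin 2) (k : ℕ) : AdmissibleTOn I W (prolong X Y L k) := by
  induction k with
  | zero => exact hY L
  | succ k ih => exact (ih.curveD hW).div (hX.curveD hW) hne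

theorem prolong_eq_of_base {t : ℝ} (hW : IsOpen W) (hX : ∀ p ∈ W, X t p = p.1)
    (hY : ∀ L, ∀ p ∈ W, Y L t p = p.2 (L, 0)) (L : Fin 2) (k : ℕ) :
    ∀ p ∈ W, prolong X Y L k t p = p.2 (L, k) := by
  induction k with
  | zero => exact hY L
  | succ k ih =>
    intro p hp
    simp only [prolong]
    rw [curveD_congr hW ih hp, curveD_congr hW hX hp, curveD_snd, curveD_fst, div_one]

theorem hasDerivAt_prolong {δ : ℝ} (hδ : 0 < δ) (hW : IsOpen W)
    (hX : AdmissibleTOn (Ioo (-δ) δ) W X) (hY : ∀ L, AdmissibleTOn (Ioo (-δ) δ) W (Y L))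
    (hne : ∀ t ∈ Ioo (-δ) δ, ∀ p ∈ W, curveD (X t) p ≠ 0)
    (hX0 : ∀ p ∈ W, X 0 p = p.1) (hY0 : ∀ L, ∀ p ∈ W, Y L 0 p = p.2 (L, 0))
    {ξ : JetB → ℝ} {η0 : Fin 2 → JetB → ℝ} (hξ : Admissible ξ) (hη : ∀ L, Admissible (η0 L))
    (hdX : ∀ p ∈ W, HasDerivAt (fun t => X t p) (ξ p) 0)
    (hdY : ∀ L, ∀ p ∈ W, HasDerivAt (fun t => Y L t p) (η0 L p) 0) (L : Fin 2) (k : ℕ) :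
    ∀ p ∈ W, HasDerivAt (fun t => prolong X Y L k t p) (etaLB ξ η0 L k p) 0 := by
  induction k with
  | zero => exact hdY L
  | succ k ih =>
    intro p hp
    have hF := admissibleTOn_prolong hW hX hY hne L k
    have h1 := hF.hasDerivAt_curveD hW hδ ih hp
    have h2 := hX.hasDerivAt_curveD hW hδ hdX hp
    have e1 : curveD (prolong X Y L k 0) p = p.2 (L, k + 1) := by
      rw [curveD_congr hW (prolong_eq_of_base hW hX0 hY0 L k) hp, curveD_snd]
    have e2 : curveD (X 0) p = 1 := by rw [curveD_congr hW hX0 hp, curveD_fst]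
    refine (h1.fun_div h2 (by simp [e2])).congr_deriv ?_
    rw [e1, e2]
    simp only [etaLB]
    rw [(hξ.etaLB hη L k).totD_eq_curveD, hξ.totD_eq_curveD]
    ring

theorem prolong_add {I : Set ℝ} (hW : IsOpen W) (hX : AdmissibleTOn I W X)
    (hY : ∀ L, AdmissibleTOn I W (Y L)) (hne : ∀ t ∈ I, ∀ p ∈ W, curveD (X t) p ≠ 0)
    {s t : ℝ} (hs : s ∈ I) (ht : t ∈ I)
    (hXadd : ∀ p ∈ W, prolongMap X Y s p ∈ W → X t (prolongMap X Y s p) = X (t + s) p)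
    (hYadd : ∀ L, ∀ p ∈ W, prolongMap X Y s p ∈ W →
      Y L t (prolongMap X Y s p) = Y L (t + s) p) (L : Fin 2) (k : ℕ) :
    ∀ p ∈ W, prolongMap X Y s p ∈ W →
      prolong X Y L k t (prolongMap X Y s p) = prolong X Y L k (t + s) p := by
  have hprol := admissibleTOn_prolong hW hX hY hne
  have key : ∀ F : ℝ → JetB → ℝ, AdmissibleTOn I W F →
      (∀ p ∈ W, prolongMap X Y s p ∈ W → F t (prolongMap X Y s p) = F (t + s) p) →
      ∀ p ∈ W, prolongMap X Y s p ∈ W →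
        curveD (X s) p * curveD (F t) (prolongMap X Y s p) = curveD (F (t + s)) p := by
    intro F hF hadd p hp hps
    have h1 := hX.hasDerivAt_jetCurve hW hs hp
    have h2 : ∀ q : Fin 2 × ℕ, HasDerivAt (fun τ => (prolongMap X Y s (jetCurve p τ)).2 q)
        (curveD (X s) p * (prolongMap X Y s (jetCurve p 0)).2 (q.1, q.2 + 1)) 0 := by
      intro q
      refine ((hprol q.1 q.2).hasDerivAt_jetCurve hW hs hp).congr_deriv ?_
      rw [jetCurve_zero]
      exact (mul_div_cancel₀ _ (hne s hs p hp)).symm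
    have hc : ContinuousAt (fun τ => prolongMap X Y s (jetCurve p τ)) 0 :=
      h1.continuousAt.prodMk (continuousAt_pi.2 fun q => (h2 q).continuousAt)
    have hps' : prolongMap X Y s (jetCurve p 0) ∈ W := by rwa [jetCurve_zero]
    have h3 := hF.hasDerivAt_curve hW ht (c := fun τ => prolongMap X Y s (jetCurve p τ)) h1 h2
      hps'
    simp only [jetCurve_zero] at h3
    refine h3.deriv.symm.trans (Filter.EventuallyEq.deriv_eq ?_)
    filter_upwards [eventually_jetCurve_mem hW hp, hc.eventually (hW.mem_nhds hps')]
      with τ h4 h5 using hadd _ h4 h5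
  induction k with
  | zero => exact hYadd L
  | succ k ih =>
    intro p hp hps
    simp only [prolong]
    rw [← key _ hX hXadd p hp hps, ← key _ (hprol L k) ih p hp hps,
      mul_div_mul_left _ _ (hne s hs p hp)]

/-- The prolongation of a local one-parameter group of base transformations generated by
`ξ, η0` exponentiates the Lie–Bäcklund field with these principal components. -/
theorem isLocalFlowOf_prolongMap {δ : ℝ} (hδ : 0 < δ) (hW : IsOpen W)
    (hX : AdmissibleTOn (Ioo (-δ) δ) W X) (hY : ∀ L, AdmissibleTOn (Ioo (-δ) δ) W (Y L))
    (hne : ∀ t ∈ Ioo (-δ) δ, ∀ p ∈ W, curveD (X t) p ≠ 0)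
    (hX0 : ∀ p ∈ W, X 0 p = p.1) (hY0 : ∀ L, ∀ p ∈ W, Y L 0 p = p.2 (L, 0))
    {ξ : JetB → ℝ} {η0 : Fin 2 → JetB → ℝ} (hξ : Admissible ξ) (hη : ∀ L, Admissible (η0 L))
    (hdX : ∀ p ∈ W, HasDerivAt (fun t => X t p) (ξ p) 0)
    (hdY : ∀ L, ∀ p ∈ W, HasDerivAt (fun t => Y L t p) (η0 L p) 0)
    (hadd : ∀ s ∈ Ioo (-δ) δ, ∀ t ∈ Ioo (-δ) δ, t + s ∈ Ioo (-δ) δ → ∀ p ∈ W,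
      prolongMap X Y s p ∈ W → X t (prolongMap X Y s p) = X (t + s) p ∧
        ∀ L, Y L t (prolongMap X Y s p) = Y L (t + s) p) :
    IsLocalFlowOf ξ η0 W δ (prolongMap X Y) := by
  refine ⟨hX, fun q => admissibleTOn_prolong hW hX hY hne q.1 q.2, fun p hp => ?_,
    fun s hs t ht hts p hp hps => ?_, hdX, fun L k =>
      hasDerivAt_prolong hδ hW hX hY hne hX0 hY0 hξ hη hdX hdY L k⟩
  · exact Prod.ext (hX0 p hp) (funext fun q => prolong_eq_of_base hW hX0 hY0 q.1 q.2 p hp)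
  · exact Prod.ext (hadd s hs t ht hts p hp hps).1 (funext fun q =>
      prolong_add hW hX hY hne hs ht (fun p hp hps => (hadd s hs t ht hts p hp hps).1)
        (fun L p hp hps => (hadd s hs t ht hts p hp hps).2 L) q.1 q.2 p hp hps)

end Prolongation

section LeafField

variable {a : Jet1 → ℝ} {b : Fin 2 → Jet1 → ℝ}

/-- The field descends to a vector field on the leaf space, which can be taken globally
Lipschitz. -/
theorem exists_leaf_field (ha : ContDiff ℝ ∞ a) (hb : ∀ L, ContDiff ℝ ∞ (b L)) {f : Jet1 → ℝ}
    (hf : ContDiff ℝ ∞ f) {P : Jet1} {R : Fin 2}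
    (hR : fderiv ℝ f P (vertCLM (Pi.single R 1)) ≠ 0)
    (h : ∀ᶠ v in 𝓝 P, ∀ h, fderiv ℝ f v (vertCLM h) = 0 → fderiv ℝ a v (vertCLM h) = 0 ∧
        (∀ L, fderiv ℝ (b L) v (vertCLM h) = 0) ∧
        fderiv ℝ (fun v => fderiv ℝ f v (firstOrderField a b v)) v (vertCLM h) = 0) :
    ∃ (Z : Leaf → Leaf) (K : NNReal), ContDiff ℝ ∞ Z ∧ LipschitzWith K Z ∧
      ∀ᶠ v in 𝓝 P, a v = (Z (leafMap f v)).1 ∧ (∀ L, b L v = (Z (leafMap f v)).2.1 L) ∧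
        fderiv ℝ f v (firstOrderField a b v) = (Z (leafMap f v)).2.2 := by
  obtain ⟨A, hA, hAc, hAe⟩ := exists_descent hf ha hR (h.mono fun v hv k hk => (hv k hk).1)
  choose B hB hBc hBe using fun L =>
    exists_descent hf (hb L) hR (h.mono fun v hv k hk => (hv k hk).2.1 L)
  obtain ⟨C, hC, hCc, hCe⟩ := exists_descent hf
    ((hf.fderiv_right (m := ∞) (by simp)).clm_apply (contDiff_firstOrderField ha hb)) hR
    (h.mono fun v hv k hk => (hv k hk).2.2)
  obtain ⟨K₁, hK₁⟩ := hA.lipschitzWith_of_hasCompactSupport hAc (by simp)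
  choose K₂ hK₂ using fun L => (hB L).lipschitzWith_of_hasCompactSupport (hBc L) (by simp)
  obtain ⟨K₃, hK₃⟩ := hC.lipschitzWith_of_hasCompactSupport hCc (by simp)
  have hBl : LipschitzWith (K₂ 0 + K₂ 1) fun c L => B L c := by
    refine fun c d => edist_pi_le_iff.2 fun L => ?_
    refine (hK₂ L c d).trans (mul_le_mul_left ?_ _)
    exact_mod_cast (by fin_cases L <;> simp : K₂ L ≤ K₂ 0 + K₂ 1)
  refine ⟨fun c => (A c, fun L => B L c, C c), max K₁ (max (K₂ 0 + K₂ 1) K₃),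
    hA.prodMk ((contDiff_pi.2 hB).prodMk hC), hK₁.prodMk (hBl.prodMk hK₃), ?_⟩
  filter_upwards [hAe, eventually_all.2 hBe, hCe] with v h1 h2 h3 using ⟨h1, h2, h3⟩

/-- The point of the leaf space with last coordinate `f v - r`. -/
def leafPoint (f : Jet1 → ℝ) (v : Jet1) (r : ℝ) : Leaf := (v.1, v.2.1, f v - r)

/-- The velocity of the first-order jet, transported by the flow of `Z` on the leaf space, of a
curve with tangent proportional to `(1, y^1, k)`. -/
noncomputable def leafLift (Z : Leaf → Leaf) (c : Leaf) (y : Fin 2 → ℝ) (k : ℝ) : Jet1 :=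
  ((Z c).1, (Z c).2.1, fun L =>
    (fderiv ℝ Z c (1, y, k)).2.1 L - y L * (fderiv ℝ Z c (1, y, k)).1)

/-- The rate of change of the defect `r = f v - w` along the transported jet. -/
noncomputable def leafDefect (f : Jet1 → ℝ) (Z : Leaf → Leaf) (z : (Jet1 × ℝ) × ℝ) : ℝ :=
  fderiv ℝ f z.1.1 (leafLift Z (leafPoint f z.1.1 z.2) z.1.1.2.2 z.1.2) -
    (Z (leafPoint f z.1.1 z.2)).2.2

theorem contDiff_leafDefect {f : Jet1 → ℝ} {Z : Leaf → Leaf} (hf : ContDiff ℝ ∞ f)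
    (hZ : ContDiff ℝ ∞ Z) : ContDiff ℝ ∞ (leafDefect f Z) := by
  have hc : ContDiff ℝ ∞ fun z : (Jet1 × ℝ) × ℝ => leafPoint f z.1.1 z.2 := by
    unfold leafPoint
    fun_prop
  have hD : ContDiff ℝ ∞ fun z : (Jet1 × ℝ) × ℝ =>
      fderiv ℝ Z (leafPoint f z.1.1 z.2) ((1 : ℝ), z.1.1.2.2, z.1.2) :=
    ((hZ.fderiv_right (m := ∞) (by simp)).comp hc).clm_apply (by fun_prop)
  have hZc := hZ.comp hc
  have hl : ContDiff ℝ ∞ fun z : (Jet1 × ℝ) × ℝ =>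
      leafLift Z (leafPoint f z.1.1 z.2) z.1.1.2.2 z.1.2 := by
    refine hZc.fst.prodMk (hZc.snd.fst.prodMk (contDiff_pi.2 fun L => ?_))
    exact ((contDiff_pi.1 hD.snd.fst) L).sub (ContDiff.mul (by fun_prop) hD.fst)
  have hf' : ContDiff ℝ ∞ fun z : (Jet1 × ℝ) × ℝ => fderiv ℝ f z.1.1 :=
    (hf.fderiv_right (m := ∞) (by simp)).comp (by fun_prop)
  exact (hf'.clm_apply hl).sub hZc.snd.snd

theorem hasFDerivAt_leafMap {f : Jet1 → ℝ} (hf : Differentiable ℝ f) (v : Jet1) :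
    HasFDerivAt (leafMap f) ((ContinuousLinearMap.fst ℝ _ _).prod
      (((ContinuousLinearMap.fst ℝ _ _).comp (ContinuousLinearMap.snd ℝ _ _)).prod
        (fderiv ℝ f v))) v :=
  hasFDerivAt_fst.prodMk (hasFDerivAt_snd.fst.prodMk (hf v).hasFDerivAt)

/-- The defect is stationary at the first-order jets on which it vanishes. -/
theorem eventually_leafDefect_eq_zero {f : Jet1 → ℝ} {Z : Leaf → Leaf} (hf : ContDiff ℝ ∞ f)
    (hZ : ContDiff ℝ ∞ Z) {P : Jet1} {R : Fin 2}
    (hR : fderiv ℝ f P (vertCLM (Pi.single R 1)) ≠ 0)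
    (hrow : ∀ R v, fderiv ℝ f v (vertCLM (charRow a b R v)) = 0)
    (h : ∀ᶠ v in 𝓝 P, a v = (Z (leafMap f v)).1 ∧ (∀ L, b L v = (Z (leafMap f v)).2.1 L) ∧
        fderiv ℝ f v (firstOrderField a b v) = (Z (leafMap f v)).2.2) :
    ∀ᶠ v in 𝓝 P, ∀ k, leafDefect f Z ((v, k), 0) = 0 := by
  have hfd : Differentiable ℝ f := hf.differentiable (by simp)
  have hRc : ContinuousAt (fun v => fderiv ℝ f v (vertCLM (Pi.single R 1))) P :=
    ((hf.continuous_fderiv (by simp)).clm_apply continuous_const).continuousAt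
  filter_upwards [hRc.eventually_ne hR, h.eventually_nhds, h] with v hRv hev hv k
  have hZd : HasFDerivAt Z (fderiv ℝ Z (leafMap f v)) (leafMap f v) :=
    (hZ.differentiable (by simp) _).hasFDerivAt
  have hcomp := hZd.comp v (hasFDerivAt_leafMap hfd v)
  set D := fderiv ℝ Z (leafMap f v) with hD
  have hda : ∀ w, fderiv ℝ a v w = (D (w.1, w.2.1, fderiv ℝ f v w)).1 := fun w => by
    rw [(hcomp.fst.congr_of_eventuallyEq (hev.mono fun v hv => hv.1)).fderiv]
    rfl
  have hdb : ∀ L w, fderiv ℝ (b L) v w = (D (w.1, w.2.1, fderiv ℝ f v w)).2.1 L := fun L w => by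
    have h1 := hasFDerivAt_pi'.1 hcomp.snd.fst L
    rw [(h1.congr_of_eventuallyEq (hev.mono fun v hv => hv.2.1 L)).fderiv]
    rfl
  have hform : ∀ L w, contactForm a b L v w = (D (w.1, w.2.1, fderiv ℝ f v w)).2.1 L -
      v.2.2 L * (D (w.1, w.2.1, fderiv ℝ f v w)).1 := fun L w => by
    rw [contactForm_apply, hda, hdb]
  set φ := fderiv ℝ f v (vertCLM (Pi.single R 1)) with hφ
  set κ := k - fderiv ℝ f v (horizVec v) with hκ
  let μ : Fin 2 → ℝ := fun L => (D (0, 0, 1)).2.1 L - v.2.2 L * (D (0, 0, 1)).1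
  have hchar : charRow a b R v = φ • μ := by
    ext L
    have : ((0 : ℝ), (0 : Fin 2 → ℝ), φ) = φ • ((0 : ℝ), (0 : Fin 2 → ℝ), (1 : ℝ)) := by simp
    simp only [charRow, hform, vertCLM_apply]
    rw [← vertCLM_apply, ← hφ, this, map_smul]
    simp [μ]
    ring
  have hμ : fderiv ℝ f v (vertCLM μ) = 0 := by
    have := hrow R v
    rw [hchar, map_smul, map_smul, smul_eq_mul] at this
    exact (mul_eq_zero.1 this).resolve_left hRv
  have hpt : leafPoint f v 0 = leafMap f v := by simp [leafPoint, leafMap]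
  have hsplit : ((1 : ℝ), v.2.2, k) = (1, v.2.2, fderiv ℝ f v (horizVec v)) +
      κ • ((0 : ℝ), (0 : Fin 2 → ℝ), (1 : ℝ)) := by simp [hκ]
  have hlift : leafLift Z (leafMap f v) v.2.2 k = firstOrderField a b v + κ • vertCLM μ := by
    refine Prod.ext ?_ (Prod.ext (funext fun L => ?_) (funext fun L => ?_))
    · simp [leafLift, firstOrderField, vertCLM_apply, hv.1]
    · simp [leafLift, firstOrderField, vertCLM_apply, hv.2.1]
    · simp only [leafLift, firstOrderField, vertCLM_apply, hform, ← hD, hsplit, map_add, map_smul]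
      simp [horizVec, μ]
      ring
  simp only [leafDefect, hpt, hlift, map_add, map_smul, hμ, hv.2.2]
  simp

end LeafField

section LeafInvariance

/-- The first-order jet of a curve through the base point of `c` with leaf velocity `J`. -/
noncomputable def leafJet (c J : Leaf) : Jet1 := (c.1, c.2.1, fun L => J.2.1 L / J.1)

theorem hasDerivAt_leafJet {Z : Leaf → Leaf} {c J : ℝ → Leaf} {t : ℝ}
    (hc : HasDerivAt c (Z (c t)) t) (hJ : HasDerivAt J (fderiv ℝ Z (c t) (J t)) t)
    (hne : (J t).1 ≠ 0) :
    HasDerivAt (fun t => leafJet (c t) (J t))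
      (leafLift Z (c t) (leafJet (c t) (J t)).2.2 ((J t).2.2 / (J t).1)) t := by
  have hscale : ((1 : ℝ), (leafJet (c t) (J t)).2.2, (J t).2.2 / (J t).1) =
      (J t).1⁻¹ • J t := by
    refine Prod.ext ?_ (Prod.ext (funext fun L => ?_) ?_)
    · simp [hne]
    · simp [leafJet, div_eq_inv_mul]
    · simp [div_eq_inv_mul]
  have hq : HasDerivAt (fun t => fun L => (J t).2.1 L / (J t).1) (fun L =>
      ((fderiv ℝ Z (c t) (J t)).2.1 L * (J t).1 - (J t).2.1 L * (fderiv ℝ Z (c t) (J t)).1) /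
        (J t).1 ^ 2) t :=
    hasDerivAt_pi.2 fun L => (hasDerivAt_pi.1 hJ.snd.fst L).fun_div hJ.fst hne
  have h1 : HasDerivAt (fun t => (c t).1) (Z (c t)).1 t := hc.fst
  have h2 : HasDerivAt (fun t => (c t).2.1) (Z (c t)).2.1 t := hc.snd.fst
  refine (h1.prodMk (h2.prodMk hq)).congr_deriv ?_
  refine Prod.ext rfl (Prod.ext rfl (funext fun L => ?_))
  simp only [leafLift, hscale, map_smul]
  simp [leafJet]
  field_simp

/-- The relation `w = f(x, y^0, y^1)` is preserved by the flow of the leaf field. -/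
theorem leafJet_mem_graph {f : Jet1 → ℝ} {Z : Leaf → Leaf} (hf : Differentiable ℝ f)
    {c J : ℝ → Leaf} {δ : ℝ} (hδ : 0 < δ) {T : Set ((Jet1 × ℝ) × ℝ)} {K : NNReal}
    (hT : LipschitzOnWith K (leafDefect f Z) T)
    (hc : ∀ t ∈ Ioo (-δ) δ, HasDerivAt c (Z (c t)) t)
    (hJ : ∀ t ∈ Ioo (-δ) δ, HasDerivAt J (fderiv ℝ Z (c t) (J t)) t)
    (hne : ∀ t ∈ Ioo (-δ) δ, (J t).1 ≠ 0)
    (hmem : ∀ t ∈ Ioo (-δ) δ, ((leafJet (c t) (J t), (J t).2.2 / (J t).1),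
      f (leafJet (c t) (J t)) - (c t).2.2) ∈ T)
    (hmem0 : ∀ t ∈ Ioo (-δ) δ, ((leafJet (c t) (J t), (J t).2.2 / (J t).1), (0 : ℝ)) ∈ T)
    (hzero : ∀ t ∈ Ioo (-δ) δ,
      leafDefect f Z ((leafJet (c t) (J t), (J t).2.2 / (J t).1), 0) = 0)
    (h0 : f (leafJet (c 0) (J 0)) = (c 0).2.2) :
    ∀ t ∈ Ioo (-δ) δ, f (leafJet (c t) (J t)) = (c t).2.2 := by
  have h := ODE_solution_unique_of_mem_Ioo
    (v := fun t r => leafDefect f Z ((leafJet (c t) (J t), (J t).2.2 / (J t).1), r))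
    (s := fun t => {r | ((leafJet (c t) (J t), (J t).2.2 / (J t).1), r) ∈ T})
    (K := K) (t₀ := 0) (a := -δ) (b := δ)
    (f := fun t => f (leafJet (c t) (J t)) - (c t).2.2) (g := fun _ => 0)
    (fun t _ r hr r' hr' => by simpa [Prod.edist_eq] using hT hr hr')
    ⟨by linarith, hδ⟩ (fun t ht => ⟨?_, hmem t ht⟩)
    (fun t ht => ⟨by simpa only [hzero t ht] using hasDerivAt_const t (0 : ℝ), hmem0 t ht⟩)
    (by simp [h0])
  · exact fun t ht => sub_eq_zero.1 (h ht)
  · have hpt : leafPoint f (leafJet (c t) (J t)) (f (leafJet (c t) (J t)) - (c t).2.2) = c t := by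
      simp [leafPoint, leafJet]
    have hv := (hf (leafJet (c t) (J t))).hasFDerivAt.comp_hasDerivAt t
      (hasDerivAt_leafJet (hc t ht) (hJ t ht) (hne t ht))
    have hw : HasDerivAt (fun t => (c t).2.2) (Z (c t)).2.2 t := (hc t ht).snd.snd
    refine (hv.sub hw).congr_deriv ?_
    simp only [leafDefect, hpt]

end LeafInvariance

section LocalFlow

/-- The total derivative of the leaf coordinates of the first-order part of a jet. -/
noncomputable def leafVel (f : Jet1 → ℝ) (p : JetB) : Leaf :=
  (1, fun L => p.2 (L, 1), fderiv ℝ f (proj1 p) (1, fun L => p.2 (L, 1), fun L => p.2 (L, 2)))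

theorem continuous_leafVel {f : Jet1 → ℝ} (hf : ContDiff ℝ ∞ f) : Continuous (leafVel f) := by
  have h1 : Continuous fun p => fderiv ℝ f (proj1 p) :=
    (hf.continuous_fderiv (by simp)).comp continuous_proj1
  exact continuous_const.prodMk (Continuous.prodMk (by fun_prop) (h1.clm_apply (by fun_prop)))

theorem continuous_leafMap {f : Jet1 → ℝ} (hf : Continuous f) : Continuous (leafMap f) := by
  unfold leafMap
  fun_prop

theorem hasDerivAt_leafMap_jetCurve {f : Jet1 → ℝ} (hf : Differentiable ℝ f) (p : JetB) :
    HasDerivAt (fun τ => leafMap f (proj1 (jetCurve p τ))) (leafVel f p) 0 := by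
  have h1 : HasDerivAt (fun τ => proj1 (jetCurve p τ))
      (1, fun L => p.2 (L, 1), fun L => p.2 (L, 2)) 0 :=
    (hasDerivAt_jetCurve_fst p).prodMk
      ((hasDerivAt_pi.2 fun L => hasDerivAt_jetCurve_snd p (L, 0)).prodMk
        (hasDerivAt_pi.2 fun L => hasDerivAt_jetCurve_snd p (L, 1)))
  refine HasFDerivAt.comp_hasDerivAt (f := fun τ => proj1 (jetCurve p τ)) 0
    (by simpa only [jetCurve_zero] using hasFDerivAt_leafMap hf (proj1 p)) h1

theorem leafJet_leafMap (f : Jet1 → ℝ) (p : JetB) :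
    leafJet (leafMap f (proj1 p)) (leafVel f p) = proj1 p := by
  simp [leafJet, leafMap, leafVel, proj1]

/-- A field whose leaf field exists near `P` is exponentiable near `P`. -/
theorem exists_localFlow_of_leaf_field {a : Jet1 → ℝ} {b : Fin 2 → Jet1 → ℝ}
    (hξ : Admissible fun p => a (proj1 p)) (hη : ∀ L, Admissible fun p => b L (proj1 p))
    {f : Jet1 → ℝ} {Z : Leaf → Leaf} {K : NNReal} (hf : ContDiff ℝ ∞ f) (hZ : ContDiff ℝ ∞ Z)
    (hK : LipschitzWith K Z) {P : Jet1}
    (hab : ∀ᶠ v in 𝓝 P, a v = (Z (leafMap f v)).1 ∧ ∀ L, b L v = (Z (leafMap f v)).2.1 L)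
    (hdefect : ∀ᶠ v in 𝓝 P, ∀ k, leafDefect f Z ((v, k), 0) = 0) :
    ∃ W : Set JetB, IsOpen W ∧ proj1 '' W ∈ 𝓝 P ∧
      ∃ δ : ℝ, 0 < δ ∧ ∃ Φ : ℝ → JetB → JetB,
        IsLocalFlowOf (fun p => a (proj1 p)) (fun L p => b L (proj1 p)) W δ Φ ∧
        (∀ t ∈ Ioo (-δ) δ, LowOrderOn W fun p => (Φ t p).1) ∧
        (∀ t ∈ Ioo (-δ) δ, ∀ L : Fin 2, LowOrderOn W fun p => (Φ t p).2 (L, 0)) := by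
  have hfd : Differentiable ℝ f := hf.differentiable (by simp)
  have hZd : Differentiable ℝ Z := hZ.differentiable (by simp)
  obtain ⟨δ₀, hδ₀, U, hU, hPU, ψ, hψs, hψ0, hψ⟩ := exists_smooth_local_flow hZ hK (leafMap f P)
  have h00 : (0 : ℝ) ∈ Ioo (-δ₀) δ₀ := ⟨by linarith, hδ₀⟩
  have hψn : ∀ {t x}, t ∈ Ioo (-δ₀) δ₀ → x ∈ U → Ioo (-δ₀) δ₀ ×ˢ U ∈ 𝓝 (t, x) := fun ht hx =>
    (isOpen_Ioo.prod hU).mem_nhds ⟨ht, hx⟩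
  have hψd : ∀ {t x}, t ∈ Ioo (-δ₀) δ₀ → x ∈ U → HasFDerivAt ψ (fderiv ℝ ψ (t, x)) (t, x) :=
    fun ht hx => ((hψs.contDiffAt (hψn ht hx)).differentiableAt (by simp)).hasFDerivAt
  let g : JetB → Leaf := fun p => leafMap f (proj1 p)
  have hg : Continuous g := (continuous_leafMap hf.continuous).comp continuous_proj1
  let J : ℝ → JetB → Leaf := fun t p => fderiv ℝ ψ (t, g p) (0, leafVel f p)
  have hcurve : ∀ {t p}, t ∈ Ioo (-δ₀) δ₀ → g p ∈ U →
      HasDerivAt (fun τ => ψ (t, g (jetCurve p τ))) (J t p) 0 := by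
    intro t p ht hp
    refine HasFDerivAt.comp_hasDerivAt (f := fun τ => (t, g (jetCurve p τ))) 0 ?_
      ((hasDerivAt_const 0 t).prodMk (hasDerivAt_leafMap_jetCurve hfd p))
    rw [jetCurve_zero]
    exact hψd ht hp
  have hJ0 : ∀ {p}, g p ∈ U → J 0 p = leafVel f p := by
    intro p hp
    refine (hcurve h00 hp).unique
      ((hasDerivAt_leafMap_jetCurve hfd p).congr_of_eventuallyEq ?_)
    have : ContinuousAt (fun τ => g (jetCurve p τ)) 0 :=
      (hg.comp (continuous_jetCurve p)).continuousAt
    filter_upwards [this.eventually (hU.mem_nhds (by simpa only [jetCurve_zero]))] with τ hτ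
      using hψ0 _ hτ
  let Θ : ℝ × JetB → (Jet1 × ℝ) × ℝ := fun z =>
    ((leafJet (ψ (z.1, g z.2)) (J z.1 z.2), (J z.1 z.2).2.2 / (J z.1 z.2).1),
      f (leafJet (ψ (z.1, g z.2)) (J z.1 z.2)) - (ψ (z.1, g z.2)).2.2)
  set p₀ := jetOfJet1 P with hp₀
  have hgp₀ : g p₀ = leafMap f P := by simp only [g, hp₀, proj1_jetOfJet1]
  have hp₀U : g p₀ ∈ U := by rwa [hgp₀]
  have hJ1 : (J 0 p₀).1 = 1 := by rw [hJ0 hp₀U]; rfl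
  set k₀ := (J 0 p₀).2.2 / (J 0 p₀).1
  have hΘ0 : Θ (0, p₀) = ((P, k₀), 0) := by
    have h1 : leafJet (ψ (0, g p₀)) (J 0 p₀) = P := by
      rw [hψ0 _ hp₀U, hJ0 hp₀U]
      exact (leafJet_leafMap f p₀).trans (proj1_jetOfJet1 P)
    have h2 : (ψ (0, g p₀)).2.2 = f P := by rw [hψ0 _ hp₀U, hgp₀]; rfl
    simp only [Θ, h1, h2, sub_self, k₀]
  have hpair : ContinuousAt (fun z : ℝ × JetB => (z.1, g z.2)) (0, p₀) := by fun_prop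
  have hψc : ContinuousAt (fun z : ℝ × JetB => ψ (z.1, g z.2)) (0, p₀) :=
    ContinuousAt.comp (f := fun z : ℝ × JetB => (z.1, g z.2)) (hψd h00 hp₀U).continuousAt hpair
  have hJc : ContinuousAt (fun z : ℝ × JetB => J z.1 z.2) (0, p₀) := by
    have h1 : ContinuousAt (fderiv ℝ ψ) (0, g p₀) :=
      ((hψs.fderiv_of_isOpen (m := 0) (isOpen_Ioo.prod hU) (by simp)).continuousOn).continuousAt
        (hψn h00 hp₀U)
    have h2 : ContinuousAt (fun z : ℝ × JetB => ((0 : ℝ), leafVel f z.2)) (0, p₀) :=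
      (continuous_const.prodMk ((continuous_leafVel hf).comp continuous_snd)).continuousAt
    exact (ContinuousAt.comp (f := fun z : ℝ × JetB => (z.1, g z.2)) h1 hpair).clm_apply h2
  have hJ1' : (J 0 p₀).1 ≠ 0 := by simp [hJ1]
  have hvc : ContinuousAt (fun z : ℝ × JetB => leafJet (ψ (z.1, g z.2)) (J z.1 z.2)) (0, p₀) :=
    hψc.fst.prodMk (hψc.snd.fst.prodMk (continuousAt_pi.2 fun L =>
      (continuousAt_pi.1 hJc.snd.fst L).div hJc.fst hJ1'))
  have hΘc : ContinuousAt Θ (0, p₀) :=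
    (hvc.prodMk (hJc.snd.snd.div hJc.fst hJ1')).prodMk
      ((hf.continuous.continuousAt.comp hvc).sub hψc.snd.snd)
  obtain ⟨K', T, hT, hTL⟩ := ((contDiff_leafDefect hf hZ).contDiffAt
    (x := ((P, k₀), (0 : ℝ)))).of_le (n := ∞) (m := 1) (by simp) |>.exists_lipschitzOnWith
  have hcond : ∀ᶠ z in 𝓝 ((P, k₀), (0 : ℝ)), z ∈ T ∧ (z.1, (0 : ℝ)) ∈ T ∧
      leafDefect f Z (z.1, 0) = 0 := by
    have h1 : ContinuousAt (fun z : (Jet1 × ℝ) × ℝ => (z.1, (0 : ℝ))) ((P, k₀), (0 : ℝ)) := by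
      fun_prop
    have h2 : ContinuousAt (fun z : (Jet1 × ℝ) × ℝ => z.1.1) ((P, k₀), (0 : ℝ)) := by
      fun_prop
    filter_upwards [hT, h1.eventually hT, h2.eventually hdefect] with z hz1 hz2 hz3
      using ⟨hz1, hz2, hz3 z.1.2⟩
  have hev : ∀ᶠ z in 𝓝 ((0 : ℝ), p₀), z.1 ∈ Ioo (-δ₀) δ₀ ∧ g z.2 ∈ U ∧ (J z.1 z.2).1 ≠ 0 ∧
      (a (proj1 z.2) = (Z (g z.2)).1 ∧ ∀ L, b L (proj1 z.2) = (Z (g z.2)).2.1 L) ∧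
      Θ z ∈ T ∧ ((Θ z).1, (0 : ℝ)) ∈ T ∧ leafDefect f Z ((Θ z).1, 0) = 0 := by
    have h1 : ContinuousAt (fun z : ℝ × JetB => proj1 z.2) (0, p₀) :=
      (continuous_proj1.comp continuous_snd).continuousAt
    have h2 : ContinuousAt (fun z : ℝ × JetB => g z.2) (0, p₀) :=
      (hg.comp continuous_snd).continuousAt
    filter_upwards [continuousAt_fst.eventually (isOpen_Ioo.mem_nhds h00),
      h2.eventually (hU.mem_nhds hp₀U), hJc.fst.eventually_ne hJ1',
      h1.eventually (by simpa only [hp₀, proj1_jetOfJet1] using hab),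
      hΘc.eventually (by simpa only [hΘ0] using hcond)]
      with z h1 h2 h3 h4 h5 using ⟨h1, h2, h3, h4, h5⟩
  obtain ⟨I, hI, W', hW', hIW⟩ := mem_nhds_prod_iff.1 hev
  obtain ⟨δ, hδ, hδI⟩ := Metric.mem_nhds_iff.1 hI
  obtain ⟨W, hWW, hW, hp₀W⟩ := mem_nhds_iff.1 hW'
  have h0 : (0 : ℝ) ∈ Ioo (-δ) δ := ⟨by linarith, hδ⟩
  have hgood := fun (t : ℝ) (ht : t ∈ Ioo (-δ) δ) (p : JetB) (hp : p ∈ W) =>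
    hIW (show (t, p) ∈ I ×ˢ W' from ⟨hδI (by simpa [Real.ball_eq_Ioo] using ht), hWW hp⟩)
  have hδδ : Ioo (-δ) δ ⊆ Ioo (-δ₀) δ₀ := fun t ht => (hgood t ht p₀ hp₀W).1
  have hgU : ∀ p ∈ W, g p ∈ U := fun p hp => (hgood 0 h0 p hp).2.1
  have hJne : ∀ t ∈ Ioo (-δ) δ, ∀ p ∈ W, (J t p).1 ≠ 0 := fun t ht p hp =>
    (hgood t ht p hp).2.2.1
  have hψδ : ∀ x ∈ U, ∀ t ∈ Ioo (-δ) δ, HasDerivAt (fun s => ψ (s, x)) (Z (ψ (t, x))) t :=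
    fun x hx t ht => hψ x hx t (hδδ ht)
  have hgraph : ∀ t ∈ Ioo (-δ) δ, ∀ p ∈ W,
      f (leafJet (ψ (t, g p)) (J t p)) = (ψ (t, g p)).2.2 := by
    intro t ht p hp
    refine leafJet_mem_graph (c := fun t => ψ (t, g p)) (J := fun t => J t p) hfd hδ hTL
      (hψδ _ (hgU p hp)) (fun t ht => hasDerivAt_fderiv_flow hZd hU hψs hψ (hgU p hp) (hδδ ht) _)
      (fun t ht => hJne t ht p hp) (fun t ht => (hgood t ht p hp).2.2.2.2.1)
      (fun t ht => (hgood t ht p hp).2.2.2.2.2.1) (fun t ht => (hgood t ht p hp).2.2.2.2.2.2)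
      ?_ t ht
    simp only [hψ0 _ (hgU p hp), hJ0 (hgU p hp)]
    exact congrArg f (leafJet_leafMap f p)
  let X : ℝ → JetB → ℝ := fun t p => (ψ (t, g p)).1
  let Y : Fin 2 → ℝ → JetB → ℝ := fun L t p => (ψ (t, g p)).2.1 L
  have hDX : ∀ t ∈ Ioo (-δ) δ, ∀ p ∈ W, curveD (X t) p = (J t p).1 := fun t ht p hp =>
    (show HasDerivAt (fun τ => X t (jetCurve p τ)) (J t p).1 0 from
      (hcurve (hδδ ht) (hgU p hp)).fst).deriv
  have hDY : ∀ L, ∀ t ∈ Ioo (-δ) δ, ∀ p ∈ W, curveD (Y L t) p = (J t p).2.1 L :=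
    fun L t ht p hp => (show HasDerivAt (fun τ => Y L t (jetCurve p τ)) ((J t p).2.1 L) 0 from
      hasDerivAt_pi.1 (hcurve (hδδ ht) (hgU p hp)).snd.fst L).deriv
  have hproj : ∀ t ∈ Ioo (-δ) δ, ∀ p ∈ W,
      proj1 (prolongMap X Y t p) = leafJet (ψ (t, g p)) (J t p) := by
    intro t ht p hp
    refine Prod.ext rfl (Prod.ext rfl (funext fun L => ?_))
    exact congrArg₂ (· / ·) (hDY L t ht p hp) (hDX t ht p hp)
  have hgΦ : ∀ t ∈ Ioo (-δ) δ, ∀ p ∈ W, g (prolongMap X Y t p) = ψ (t, g p) := by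
    intro t ht p hp
    simp only [g, hproj t ht p hp]
    exact Prod.ext rfl (Prod.ext rfl (hgraph t ht p hp))
  have hadm : ∀ F : Leaf → ℝ, ContDiff ℝ ∞ F →
      AdmissibleTOn (Ioo (-δ) δ) W fun t p => F (ψ (t, g p)) := by
    intro F hF
    have hlm : ContDiff ℝ ∞ (leafMap f) := contDiff_fst.prodMk (contDiff_snd.fst.prodMk hf)
    have hm : ContDiff ℝ ∞ fun z : ℝ × Jet1 => (z.1, leafMap f z.2) :=
      contDiff_fst.prodMk (hlm.comp contDiff_snd)
    exact admissibleTOn_of_jet1 (V := (fun z : ℝ × Jet1 => (z.1, leafMap f z.2)) ⁻¹'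
      (Ioo (-δ₀) δ₀ ×ˢ U)) (G := fun z => F (ψ (z.1, leafMap f z.2)))
      ((isOpen_Ioo.prod hU).preimage hm.continuous)
      (hF.comp_contDiffOn (hψs.comp hm.contDiffOn fun _ h => h))
      fun t ht p hp => ⟨hδδ ht, hgU p hp⟩
  have hd0 : ∀ p ∈ W, HasDerivAt (fun t => ψ (t, g p)) (Z (g p)) 0 := fun p hp => by
    simpa only [hψ0 _ (hgU p hp)] using hψ _ (hgU p hp) 0 h00
  have hlow : ∀ p q : JetB, p.1 = q.1 →
      (∀ (L : Fin 2) (k : ℕ), k ≤ 1 → p.2 (L, k) = q.2 (L, k)) → g p = g q := by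
    intro p q h1 h2
    have : proj1 p = proj1 q := Prod.ext h1 (Prod.ext (funext fun L => h2 L 0 zero_le_one)
      (funext fun L => h2 L 1 le_rfl))
    simp only [g, this]
  refine ⟨W, hW, ?_, δ, hδ, prolongMap X Y, isLocalFlowOf_prolongMap hδ hW
    (hadm (fun c => c.1) contDiff_fst) (fun L => hadm (fun c => c.2.1 L) (by fun_prop))
    (fun t ht p hp => by rw [hDX t ht p hp]; exact hJne t ht p hp)
    (fun p hp => congrArg Prod.fst (hψ0 _ (hgU p hp)))
    (fun L p hp => congrArg (fun c : Leaf => c.2.1 L) (hψ0 _ (hgU p hp)))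
    hξ hη (fun p hp => ?_) (fun L p hp => ?_) (fun s hs t ht hts p hp hps => ?_),
    fun t _ p _ q _ h1 h2 => congrArg (fun c => (ψ (t, c)).1) (hlow p q h1 h2),
    fun t _ L p _ q _ h1 h2 => congrArg (fun c => (ψ (t, c)).2.1 L) (hlow p q h1 h2)⟩
  · filter_upwards [continuous_jetOfJet1.continuousAt.preimage_mem_nhds (hW.mem_nhds hp₀W)]
      with v hv using ⟨jetOfJet1 v, hv, proj1_jetOfJet1 v⟩
  · rw [(hgood 0 h0 p hp).2.2.2.1.1]
    exact (hd0 p hp).fst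
  · rw [(hgood 0 h0 p hp).2.2.2.1.2 L]
    exact hasDerivAt_pi.1 (hd0 p hp).snd.fst L
  · have hadd : ψ (t, g (prolongMap X Y s p)) = ψ (t + s, g p) := by
      have hmem := hgU _ hps
      rw [hgΦ s hs p hp] at hmem ⊢
      exact flow_add hK hψ0 hψδ (hgU p hp) hs ht hts hmem
    exact ⟨congrArg Prod.fst hadd, fun L => congrArg (fun c : Leaf => c.2.1 L) hadd⟩

end LocalFlow

end JetFlows

/-- sufficiency: if the matrix `(M^Q_L)` is nonzero at a point `P` of
`J^1(ℝ,ℝ²)` and identities (i) and (ii) hold, then the Lie–Bäcklund field with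
principal components `ξ, η^0_1, η^0_2` (depending only on first-order coordinates)
is exponentiable to a local flow, defined on a set projecting onto a neighborhood
of `P`, whose components `Ξ_t` and `H^0_{L,t}` do not depend on the coordinates
`y^γ_M` with `γ ≥ 2`. -/
theorem theorem7_sufficiency (ξ : JetB → ℝ) (η0 : Fin 2 → JetB → ℝ)
    (hξadm : Admissible ξ) (hη0adm : ∀ L, Admissible (η0 L))
    (hξlow : LowOrder ξ) (hη0low : ∀ L, LowOrder (η0 L))
    (xb : ℝ) (y0b y1b : Fin 2 → ℝ)
    (hM : ∃ p₀ : JetB, p₀.1 = xb ∧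
      (∀ L : Fin 2, p₀.2 (L, 0) = y0b L ∧ p₀.2 (L, 1) = y1b L) ∧
      ∃ Q L : Fin 2, Mcomp ξ η0 Q L p₀ ≠ 0)
    (hi : ∀ (R L : Fin 2) (p : JetB),
        (∑ M, Mcomp ξ η0 R M p * pdY (M, 1) ξ p) = 0 ∧
        (∑ M, Mcomp ξ η0 R M p * pdY (M, 1) (η0 L) p) = 0)
    (hii : ∀ (R L : Fin 2) (p : JetB),
        (∑ M, Qcomp ξ η0 R M p * pdY (M, 1) ξ p) = 0 ∧
        (∑ M, Qcomp ξ η0 R M p * pdY (M, 1) (η0 L) p) = 0) :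
    ∃ W : Set JetB, IsOpen W ∧ proj1 '' W ∈ nhds (xb, y0b, y1b) ∧
      ∃ δ : ℝ, 0 < δ ∧ ∃ Φ : ℝ → JetB → JetB,
        IsLocalFlowOf ξ η0 W δ Φ ∧
        (∀ t ∈ Set.Ioo (-δ) δ, LowOrderOn W fun p => (Φ t p).1) ∧
        (∀ t ∈ Set.Ioo (-δ) δ, ∀ L : Fin 2,
          LowOrderOn W fun p => (Φ t p).2 (L, 0)) := by
  obtain ⟨a, ha, rfl⟩ := hξlow.exists_jet1 hξadm
  choose b hb hbη using fun L => (hη0low L).exists_jet1 (hη0adm L)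
  obtain rfl : η0 = fun L p => b L (proj1 p) := funext hbη
  have had : Differentiable ℝ a := ha.differentiable (by simp)
  have hbd : ∀ L, Differentiable ℝ (b L) := fun L => (hb L).differentiable (by simp)
  have hm : ∃ Q, charRow a b Q (xb, y0b, y1b) ≠ 0 := by
    obtain ⟨p₀, h1, h2, Q, L, hQL⟩ := hM
    have hp₀ : proj1 p₀ = (xb, y0b, y1b) :=
      Prod.ext h1 (Prod.ext (funext fun L => (h2 L).1) (funext fun L => (h2 L).2))
    simp only [Mcomp_comp_proj1 ha hb, hp₀] at hQL
    exact ⟨Q, fun h => hQL (congrFun h L)⟩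
  have hi' : ∀ G, (G = a ∨ ∃ L, G = b L) → ∀ R v,
      fderiv ℝ G v (vertCLM (charRow a b R v)) = 0 := by
    intro G hG R v
    rw [fderiv_vertCLM]
    rcases hG with rfl | ⟨L, rfl⟩
    · simpa only [Mcomp_comp_proj1 ha hb, pdY_comp_proj1 had, proj1_single_one,
        proj1_jetOfJet1, ← vertCLM_apply] using (hi R 0 (jetOfJet1 v)).1
    · simpa only [Mcomp_comp_proj1 ha hb, pdY_comp_proj1 (hbd L), proj1_single_one,
        proj1_jetOfJet1, ← vertCLM_apply] using (hi R L (jetOfJet1 v)).2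
  obtain ⟨f, hf, hrow, ⟨R, hR⟩, hfe⟩ := exists_vertical_generator ha hb hm hi' (by
    intro G hG R v
    rw [fderiv_vertCLM]
    rcases hG with rfl | ⟨L, rfl⟩
    · simpa only [Qcomp_comp_proj1 ha hb, pdY_comp_proj1 had, proj1_single_one,
        proj1_jetOfJet1, ← vertCLM_apply] using (hii R 0 (jetOfJet1 v)).1
    · simpa only [Qcomp_comp_proj1 ha hb, pdY_comp_proj1 (hbd L), proj1_single_one,
        proj1_jetOfJet1, ← vertCLM_apply] using (hii R L (jetOfJet1 v)).2)
  obtain ⟨Z, K, hZ, hK, hZe⟩ := exists_leaf_field ha hb hf hR hfe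
  exact exists_localFlow_of_leaf_field hξadm hη0adm hf hZ hK
    (hZe.mono fun v hv => ⟨hv.1, hv.2.1⟩) (eventually_leafDefect_eq_zero hf hZ hR hrow hZe)
end
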